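/- Let w be a cyclically reduced word over {x,y,z} of even length at least 4 in which all three letters x, y, z occur (w need not be primitive). Then φ(w) is hyperbolic and I(w) ≥ L(w) − 1. -/

import Mathlib

open scoped Classical

abbrev SL2Z := Matrix.SpecialLinearGroup (Fin 2) ℤ

def Amat : SL2Z := ⟨!![1, 2; 0, 1], by norm_num [Matrix.det_fin_two_of]⟩
def Bmat : SL2Z := ⟨!![1, 0; -2, 1], by norm_num [Matrix.det_fin_two_of]⟩
def Cmat : SL2Z := (Amat * Bmat)⁻¹

def Gamma : Subgroup SL2Z := Subgroup.closure {Amat, Bmat}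

/-- The real entry `i j` of a matrix in `SL₂(ℤ)`. -/
def entry (g : SL2Z) (i j : Fin 2) : ℝ := ((g : Matrix (Fin 2) (Fin 2) ℤ) i j : ℤ)

/-- The Möbius action of `SL₂(ℤ)` on the circle `ℝ ∪ {∞}`. -/
noncomputable def mobius (g : SL2Z) (p : OnePoint ℝ) : OnePoint ℝ :=
  Option.rec (motive := fun _ => OnePoint ℝ)
    (if entry g 1 0 = 0 then OnePoint.infty
     else OnePoint.some (entry g 0 0 / entry g 1 0))
    (fun x => if entry g 1 0 * x + entry g 1 1 = 0 then OnePoint.infty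
      else OnePoint.some ((entry g 0 0 * x + entry g 0 1) / (entry g 1 0 * x + entry g 1 1)))
    p

/-- The fixed-point set of `g` acting on the circle `ℝ ∪ {∞}`. -/
noncomputable def fixedSet (g : SL2Z) : Set (OnePoint ℝ) := {p | mobius g p = p}

/-- `g` is hyperbolic if `|trace g| > 2`. -/
def Hyperbolic (g : SL2Z) : Prop := 2 < |Matrix.trace (g : Matrix (Fin 2) (Fin 2) ℤ)|

/-- Two two-element subsets of the circle are linked if the two points of `Q` lie in
different connected components of the complement of `P`. -/
def Linked (P Q : Set (OnePoint ℝ)) : Prop :=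
  ∃ q₁ q₂ : OnePoint ℝ, q₁ ≠ q₂ ∧ Q = {q₁, q₂} ∧
    connectedComponentIn Pᶜ q₁ ≠ connectedComponentIn Pᶜ q₂

/-- `h` contributes to the count `s(v)`: `v` and `h * v * h⁻¹` are hyperbolic with
linked fixed-point sets. -/
def GoodConj (v h : Gamma) : Prop :=
  Hyperbolic (v : SL2Z) ∧ Hyperbolic ((h * v * h⁻¹ : Gamma) : SL2Z) ∧
    Linked (fixedSet (v : SL2Z)) (fixedSet ((h * v * h⁻¹ : Gamma) : SL2Z))

/-- Twice `s(v)`: the number of double cosets `⟨v⟩ h ⟨v⟩` in `Γ` such that `v` and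
`h * v * h⁻¹` are hyperbolic with linked fixed-point sets. -/
noncomputable def sTwo (v : Gamma) : ℕ :=
  Nat.card (Quot (fun h h' : {h : Gamma // GoodConj v h} =>
    ∃ m k : ℤ, (h' : Gamma) = v ^ m * (h : Gamma) * v ^ k))

/-- `v` is not a proper power in `Γ`. -/
def NotProperPower (v : Gamma) : Prop := ¬ ∃ u : Gamma, ∃ k : ℕ, 2 ≤ k ∧ v = u ^ k

/-- The self-intersection number `I(g) = n² s(v) + n - 1`, where `g = vⁿ` with `v` not a
proper power and `n ≥ 1`, and `s(v)` is half the number of good double cosets. -/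
noncomputable def Iγ (g : Gamma) : ℤ :=
  if h : ∃ p : Gamma × ℕ, 1 ≤ p.2 ∧ NotProperPower p.1 ∧ g = p.1 ^ p.2 then
    (h.choose.2 : ℤ) ^ 2 * ((sTwo h.choose.1 / 2 : ℕ) : ℤ) + (h.choose.2 : ℤ) - 1
  else 0
/-- The three-letter alphabet `{x, y, z}`. -/
inductive Letter | x | y | z
deriving DecidableEq

/-- The letter of `w` at cyclic position `i`. -/
def cget (w : List Letter) (i : ℕ) : Letter := w.getD (i % w.length) Letter.x

/-- `w` is cyclically reduced: nonempty, and any two cyclically consecutive letters differ. -/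
def CyclRed (w : List Letter) : Prop :=
  w ≠ [] ∧ ∀ i : ℕ, i < w.length → cget w i ≠ cget w (i + 1)

/-- The matrix assigned to a consecutive pair of letters:
`xy ↦ A`, `yx ↦ A⁻¹`, `yz ↦ B`, `zy ↦ B⁻¹`, `zx ↦ C`, `xz ↦ C⁻¹`. -/
def pairM : Letter → Letter → SL2Z
  | .x, .y => Amat
  | .y, .x => Amat⁻¹
  | .y, .z => Bmat
  | .z, .y => Bmat⁻¹
  | .z, .x => Cmat
  | .x, .z => Cmat⁻¹
  | _, _ => 1

/-- `φ(w)`: group the letters of `w` into consecutive pairs and multiply the matrices. -/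
def phiM : List Letter → SL2Z
  | [] => 1
  | [_] => 1
  | a :: b :: t => pairM a b * phiM t

lemma pairM_mem (a b : Letter) : pairM a b ∈ Gamma := by
  have hA : Amat ∈ Gamma := Subgroup.subset_closure (by simp)
  have hB : Bmat ∈ Gamma := Subgroup.subset_closure (by simp)
  have hC : Cmat ∈ Gamma := inv_mem (mul_mem hA hB)
  cases a <;> cases b <;>
    simp only [pairM] <;>
    first
      | exact hA | exact hB | exact hC
      | exact inv_mem hA | exact inv_mem hB | exact inv_mem hC
      | exact one_mem _

lemma phiM_mem : ∀ w : List Letter, phiM w ∈ Gamma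
  | [] => one_mem _
  | [_] => one_mem _
  | _ :: b :: t => mul_mem (pairM_mem _ b) (phiM_mem t)

/-- The self-intersection number of the word `w`. -/
noncomputable def Iw (w : List Letter) : ℤ := Iγ ⟨phiM w, phiM_mem w⟩

/-- The combinatorial length `L(w)` (half the number of letters). -/
def Lw (w : List Letter) : ℤ := (w.length : ℤ) / 2

/-! ### Entries and traces in `SL₂(ℤ)` -/

/-- The trace of an element of `SL₂(ℤ)`. -/
def tr (g : SL2Z) : ℤ := g.1 0 0 + g.1 1 1

lemma hyperbolic_iff_tr (g : SL2Z) : Hyperbolic g ↔ 2 < |tr g| := by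
  simp only [Hyperbolic, tr, Matrix.trace_fin_two]

lemma det_entries (g : SL2Z) : g.1 0 0 * g.1 1 1 - g.1 0 1 * g.1 1 0 = 1 := by
  rw [← Matrix.det_fin_two, g.2]

lemma mul_entry (g h : SL2Z) (i j : Fin 2) :
    (g * h).1 i j = g.1 i 0 * h.1 0 j + g.1 i 1 * h.1 1 j := by
  simp [Matrix.mul_apply, Fin.sum_univ_two]

lemma inv_entry_00 (g : SL2Z) : (g⁻¹).1 0 0 = g.1 1 1 := by
  rw [Matrix.SpecialLinearGroup.SL2_inv_expl]; rfl

lemma inv_entry_01 (g : SL2Z) : (g⁻¹).1 0 1 = -g.1 0 1 := by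
  rw [Matrix.SpecialLinearGroup.SL2_inv_expl]; rfl

lemma inv_entry_10 (g : SL2Z) : (g⁻¹).1 1 0 = -g.1 1 0 := by
  rw [Matrix.SpecialLinearGroup.SL2_inv_expl]; rfl

lemma inv_entry_11 (g : SL2Z) : (g⁻¹).1 1 1 = g.1 0 0 := by
  rw [Matrix.SpecialLinearGroup.SL2_inv_expl]; rfl

lemma neg_entry (g : SL2Z) (i j : Fin 2) : (-g).1 i j = -g.1 i j := rfl

lemma one_entry_00 : (1 : SL2Z).1 0 0 = 1 := rfl
lemma one_entry_01 : (1 : SL2Z).1 0 1 = 0 := rfl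
lemma one_entry_10 : (1 : SL2Z).1 1 0 = 0 := rfl
lemma one_entry_11 : (1 : SL2Z).1 1 1 = 1 := rfl

lemma SL2Z_ext {g h : SL2Z} (h00 : g.1 0 0 = h.1 0 0) (h01 : g.1 0 1 = h.1 0 1)
    (h10 : g.1 1 0 = h.1 1 0) (h11 : g.1 1 1 = h.1 1 1) : g = h := by
  ext i j
  fin_cases i <;> fin_cases j <;> assumption

lemma tr_mul_comm (g h : SL2Z) : tr (g * h) = tr (h * g) := by
  simp only [tr, mul_entry]; ring

lemma tr_conj (g h : SL2Z) : tr (h * g * h⁻¹) = tr g := by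
  rw [tr_mul_comm, inv_mul_cancel_left]

lemma tr_inv (g : SL2Z) : tr g⁻¹ = tr g := by
  simp only [tr, inv_entry_00, inv_entry_11]; ring

lemma tr_neg (g : SL2Z) : tr (-g) = -tr g := by
  simp only [tr, neg_entry]; ring

lemma tr_mul_inv (g h : SL2Z) : tr (g * h⁻¹) = tr g * tr h - tr (g * h) := by
  simp only [tr, mul_entry, inv_entry_00, inv_entry_01, inv_entry_10, inv_entry_11]; ring

lemma tr_sq (g : SL2Z) : tr (g * g) = tr g ^ 2 - 2 := by
  simp only [tr, mul_entry]
  linear_combination (-2) * det_entries g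

/-- The axes of `g` and `h * g * h⁻¹` cross, phrased through traces. -/
def Crosses (g h : SL2Z) : Prop :=
  2 < tr (g * (h * g * h⁻¹)) ∧ tr (g * (h * g * h⁻¹)) < tr g ^ 2 - 2

lemma crosses_of_tr_gt {g h : SL2Z} (h₁ : 2 < tr (g * (h * g * h⁻¹)))
    (h₂ : 2 < tr (g * (h * g * h⁻¹)⁻¹)) : Crosses g h := by
  refine ⟨h₁, ?_⟩
  rw [tr_mul_inv, tr_conj] at h₂
  linarith

lemma Crosses.inv {g h : SL2Z} (H : Crosses g h) : Crosses g h⁻¹ := by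
  have : tr (g * (h⁻¹ * g * h⁻¹⁻¹)) = tr (g * (h * g * h⁻¹)) := by
    rw [tr_mul_comm g (h * g * h⁻¹), ← tr_conj (g * (h⁻¹ * g * h⁻¹⁻¹)) h]
    congr 1; group
  rwa [Crosses, this]

lemma Crosses.of_commute {g h a b : SL2Z} (ha : Commute a g) (hb : Commute b g)
    (H : Crosses g h) : Crosses g (a * h * b) := by
  have hb' : b * g * b⁻¹ = g := by rw [hb.eq, mul_inv_cancel_right]
  have ha' : a⁻¹ * g * a = g := by rw [mul_assoc, ← ha.eq, inv_mul_cancel_left]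
  have : tr (g * (a * h * b * g * (a * h * b)⁻¹)) = tr (g * (h * g * h⁻¹)) := by
    rw [show g * (a * h * b * g * (a * h * b)⁻¹)
      = a * ((a⁻¹ * g * a) * (h * (b * g * b⁻¹) * h⁻¹)) * a⁻¹ by group, tr_conj, ha', hb']
  rwa [Crosses, this]

lemma Crosses.neg_left {g h : SL2Z} (H : Crosses g h) : Crosses (-g) h := by
  have : tr (-g * (h * -g * h⁻¹)) = tr (g * (h * g * h⁻¹)) := by
    congr 1; simp
  rw [Crosses, this, tr_neg, neg_sq]; exact H

lemma Crosses.neg_right {g h : SL2Z} (H : Crosses g h) : Crosses g (-h) := by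
  have e : (-h)⁻¹ = -h⁻¹ := by
    rw [inv_eq_iff_mul_eq_one]; simp
  have : tr (g * (-h * g * (-h)⁻¹)) = tr (g * (h * g * h⁻¹)) := by
    rw [e]; congr 1; simp
  rwa [Crosses, this]

/-- A conjugator whose double coset is inverse to itself does not give a crossing. -/
lemma not_crosses_of_sq_eq_zpow {v f : SL2Z} {j : ℤ} (hf : f * f = v ^ j) : ¬ Crosses v f := by
  intro H
  have hdet := det_entries f
  by_cases hs : tr f = 0
  · have : tr (v * (f * v * f⁻¹)) = 2 - tr (v * f) ^ 2 := by
      have hinv : f⁻¹ = -f := by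
        have hs' : f.1 1 1 = - f.1 0 0 := by simp only [tr] at hs; linarith
        apply SL2Z_ext <;>
          simp only [inv_entry_00, inv_entry_01, inv_entry_10, inv_entry_11, neg_entry, hs']
        ring
      rw [hinv, show v * (f * v * -f) = -((v * f) * (v * f)) by simp [mul_assoc], tr_neg, tr_sq]
      ring
    have h1 := H.1
    rw [this] at h1
    nlinarith [sq_nonneg (tr (v * f))]
  · have hcomm : Commute v (f * f) := by rw [hf]; exact (Commute.refl v).zpow_right j
    have hfv : f * v = v * f := by
      have key : ∀ i k : Fin 2, tr f * ((f * v).1 i k - (v * f).1 i k) = 0 := by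
        intro i k
        have h1 : (v * (f * f)).1 i k = (f * f * v).1 i k := by rw [hcomm.eq]
        simp only [mul_entry] at h1
        fin_cases i <;> fin_cases k <;>
          simp only [tr, mul_entry, Fin.zero_eta, Fin.mk_one, Fin.isValue] at h1 ⊢ <;>
          linear_combination -h1
      have key' : ∀ i k : Fin 2, (f * v).1 i k = (v * f).1 i k := fun i k =>
        sub_eq_zero.mp ((mul_eq_zero.mp (key i k)).resolve_left hs)
      exact SL2Z_ext (key' _ _) (key' _ _) (key' _ _) (key' _ _)
    have h2 := H.2
    rw [hfv, mul_inv_cancel_right, tr_sq] at h2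
    exact lt_irrefl _ h2

/-! ### Linking of pairs of real points -/

lemma isPreconnected_outside (p₁ p₂ : ℝ) :
    IsPreconnected (((↑) : ℝ → OnePoint ℝ) '' Set.Iio p₁ ∪ {OnePoint.infty} ∪
      ((↑) : ℝ → OnePoint ℝ) '' Set.Ioi p₂) := by
  have hcoe : Continuous ((↑) : ℝ → OnePoint ℝ) := OnePoint.continuous_coe
  have key : ∀ s : Set ℝ, IsPreconnected s → (∀ K : Set ℝ, IsCompact K → (s \ K).Nonempty) →
      IsPreconnected (((↑) : ℝ → OnePoint ℝ) '' s ∪ {OnePoint.infty}) := by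
    intro s hs hK
    refine (hs.image _ hcoe.continuousOn).subset_closure Set.subset_union_left ?_
    rintro p (hp | rfl)
    · exact subset_closure hp
    · rw [mem_closure_iff]
      intro o ho hmem
      rw [OnePoint.isOpen_def] at ho
      obtain ⟨x, hxs, hxK⟩ := hK _ (ho.1 hmem)
      exact ⟨x, by simpa using hxK, x, hxs, rfl⟩
  have h₁ := key (Set.Iio p₁) isPreconnected_Iio (by
    intro K hK
    obtain ⟨b, hb⟩ := hK.bddBelow
    refine ⟨min b p₁ - 1, ?_, fun h => ?_⟩
    · have := min_le_right b p₁
      simp only [Set.mem_Iio]; linarith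
    · have h1 := hb h
      have := min_le_left b p₁
      linarith)
  have h₂ := key (Set.Ioi p₂) isPreconnected_Ioi (by
    intro K hK
    obtain ⟨b, hb⟩ := hK.bddAbove
    refine ⟨max b p₂ + 1, ?_, fun h => ?_⟩
    · have := le_max_right b p₂
      simp only [Set.mem_Ioi]; linarith
    · have h1 := hb h
      have := le_max_left b p₂
      linarith)
  have := IsPreconnected.union OnePoint.infty (by simp) (by simp) h₁ h₂
  convert this using 1
  ext x
  simp only [Set.mem_union]
  tauto

lemma connectedComponentIn_ne_iff {p₁ p₂ q₁ q₂ : ℝ} (hp : p₁ < p₂)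
    (h₁ : (q₁ - p₁) * (q₁ - p₂) ≠ 0) (h₂ : (q₂ - p₁) * (q₂ - p₂) ≠ 0) :
    connectedComponentIn ({(p₁ : OnePoint ℝ), (p₂ : OnePoint ℝ)}ᶜ) (q₁ : OnePoint ℝ) ≠
      connectedComponentIn ({(p₁ : OnePoint ℝ), (p₂ : OnePoint ℝ)}ᶜ) (q₂ : OnePoint ℝ) ↔
    (q₁ - p₁) * (q₁ - p₂) * ((q₂ - p₁) * (q₂ - p₂)) < 0 := by
  set F : Set (OnePoint ℝ) := {(p₁ : OnePoint ℝ), (p₂ : OnePoint ℝ)}ᶜ with hF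
  have mem_F : ∀ q : ℝ, (q - p₁) * (q - p₂) ≠ 0 → (q : OnePoint ℝ) ∈ F := by
    intro q hq
    simp only [hF, Set.mem_compl_iff, Set.mem_insert_iff, Set.mem_singleton_iff,
      OnePoint.coe_eq_coe, not_or]
    constructor <;> rintro rfl <;> simp at hq
  have inside : ∀ q : ℝ, (q - p₁) * (q - p₂) < 0 → q ∈ Set.Ioo p₁ p₂ := by
    intro q hq
    constructor <;> nlinarith
  have outside : ∀ q : ℝ, 0 < (q - p₁) * (q - p₂) → q < p₁ ∨ p₂ < q := by
    intro q hq
    by_contra! h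
    nlinarith
  have same : ∀ s : Set (OnePoint ℝ), IsPreconnected s → s ⊆ F → (q₁ : OnePoint ℝ) ∈ s →
      (q₂ : OnePoint ℝ) ∈ s → connectedComponentIn F (q₁ : OnePoint ℝ) =
        connectedComponentIn F (q₂ : OnePoint ℝ) := fun s hs hsF a b =>
    connectedComponentIn_eq (hs.subset_connectedComponentIn a hsF b)
  have outside_sub : (((↑) : ℝ → OnePoint ℝ) '' Set.Iio p₁ ∪ {OnePoint.infty} ∪
      ((↑) : ℝ → OnePoint ℝ) '' Set.Ioi p₂) ⊆ F := by
    rintro _ ((⟨x, hx, rfl⟩ | rfl) | ⟨x, hx, rfl⟩)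
    · simp only [Set.mem_Iio] at hx
      exact mem_F x (mul_pos_of_neg_of_neg (by linarith) (by linarith)).ne'
    · simp [hF, OnePoint.infty_ne_coe]
    · simp only [Set.mem_Ioi] at hx
      exact mem_F x (mul_pos (by linarith) (by linarith)).ne'
  have inside_sub : ((↑) : ℝ → OnePoint ℝ) '' Set.Ioo p₁ p₂ ⊆ F := by
    rintro _ ⟨x, hx, rfl⟩
    exact mem_F x (mul_neg_of_pos_of_neg (by linarith [hx.1]) (by linarith [hx.2])).ne
  have mem_out : ∀ q : ℝ, 0 < (q - p₁) * (q - p₂) →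
      (q : OnePoint ℝ) ∈ (((↑) : ℝ → OnePoint ℝ) '' Set.Iio p₁ ∪ {OnePoint.infty} ∪
        ((↑) : ℝ → OnePoint ℝ) '' Set.Ioi p₂) := by
    intro q hq
    rcases outside q hq with h | h
    · exact Or.inl (Or.inl ⟨q, h, rfl⟩)
    · exact Or.inr ⟨q, h, rfl⟩
  have diff : ∀ a b : ℝ, (a - p₁) * (a - p₂) < 0 → 0 < (b - p₁) * (b - p₂) →
      connectedComponentIn F (a : OnePoint ℝ) ≠ connectedComponentIn F (b : OnePoint ℝ) := by
    intro a b ha hb heq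
    have hU : IsOpen (((↑) : ℝ → OnePoint ℝ) '' Set.Ioo p₁ p₂) :=
      OnePoint.isOpenEmbedding_coe.isOpenMap _ isOpen_Ioo
    have hV : IsOpen ((((↑) : ℝ → OnePoint ℝ) '' Set.Icc p₁ p₂)ᶜ) :=
      (isCompact_Icc.image OnePoint.continuous_coe).isClosed.isOpen_compl
    have ma := mem_connectedComponentIn (mem_F a ha.ne)
    have mb := mem_connectedComponentIn (mem_F b hb.ne')
    rw [← heq] at mb
    obtain ⟨z, -, ⟨x, hx, rfl⟩, hz⟩ :=
      isPreconnected_connectedComponentIn _ _ hU hV (by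
        intro z hz
        by_cases hzI : z ∈ ((↑) : ℝ → OnePoint ℝ) '' Set.Icc p₁ p₂
        · left
          obtain ⟨x, hx, rfl⟩ := hzI
          have := connectedComponentIn_subset _ _ hz
          simp only [hF, Set.mem_compl_iff, Set.mem_insert_iff, Set.mem_singleton_iff,
            OnePoint.coe_eq_coe, not_or] at this
          exact ⟨x, ⟨lt_of_le_of_ne hx.1 (Ne.symm this.1), lt_of_le_of_ne hx.2 this.2⟩, rfl⟩
        · exact Or.inr hzI) ⟨a, ma, a, inside a ha, rfl⟩
        ⟨b, mb, by
          rintro ⟨x, hx, hxb⟩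
          rw [OnePoint.coe_eq_coe] at hxb
          subst hxb
          rcases outside x hb with h | h
          · linarith [hx.1]
          · linarith [hx.2]⟩
    exact hz ⟨x, ⟨hx.1.le, hx.2.le⟩, rfl⟩
  constructor
  · intro hne
    by_contra! hpos
    apply hne
    rcases lt_or_gt_of_ne h₁ with a | a <;> rcases lt_or_gt_of_ne h₂ with b | b
    · exact same _ (isPreconnected_Ioo.image _ OnePoint.continuous_coe.continuousOn) inside_sub
        ⟨q₁, inside _ a, rfl⟩ ⟨q₂, inside _ b, rfl⟩
    · exact absurd hpos (not_le.mpr (mul_neg_of_neg_of_pos a b))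
    · exact absurd hpos (not_le.mpr (mul_neg_of_pos_of_neg a b))
    · exact same _ (isPreconnected_outside p₁ p₂) outside_sub (mem_out _ a) (mem_out _ b)
  · intro hneg
    rcases lt_or_gt_of_ne h₁ with a | a <;> rcases lt_or_gt_of_ne h₂ with b | b
    · exact absurd hneg (not_lt.mpr (mul_pos_of_neg_of_neg a b).le)
    · exact diff _ _ a b
    · exact (diff _ _ b a).symm
    · exact absurd hneg (not_lt.mpr (mul_pos a b).le)

lemma linked_pair_iff {p₁ p₂ q₁ q₂ : ℝ} (hp : p₁ < p₂) (hq : q₁ ≠ q₂)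
    (hcommon : (q₁ - p₁) * (q₁ - p₂) = 0 ↔ (q₂ - p₁) * (q₂ - p₂) = 0) :
    Linked {(p₁ : OnePoint ℝ), (p₂ : OnePoint ℝ)} {(q₁ : OnePoint ℝ), (q₂ : OnePoint ℝ)} ↔
    (q₁ - p₁) * (q₁ - p₂) * ((q₂ - p₁) * (q₂ - p₂)) < 0 := by
  have swap : Linked {(p₁ : OnePoint ℝ), (p₂ : OnePoint ℝ)}
      {(q₁ : OnePoint ℝ), (q₂ : OnePoint ℝ)} ↔
      connectedComponentIn ({(p₁ : OnePoint ℝ), (p₂ : OnePoint ℝ)}ᶜ) (q₁ : OnePoint ℝ) ≠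
      connectedComponentIn ({(p₁ : OnePoint ℝ), (p₂ : OnePoint ℝ)}ᶜ) (q₂ : OnePoint ℝ) := by
    constructor
    · rintro ⟨a, b, -, hQ, hne⟩
      rcases Set.pair_eq_pair_iff.mp hQ with ⟨rfl, rfl⟩ | ⟨rfl, rfl⟩
      · exact hne
      · exact hne.symm
    · intro h
      exact ⟨q₁, q₂, by simpa using hq, rfl, h⟩
  rw [swap]
  by_cases h₁ : (q₁ - p₁) * (q₁ - p₂) = 0
  · have h₂ := hcommon.mp h₁
    have empty : ∀ q : ℝ, (q - p₁) * (q - p₂) = 0 →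
        connectedComponentIn ({(p₁ : OnePoint ℝ), (p₂ : OnePoint ℝ)}ᶜ) (q : OnePoint ℝ) = ∅ := by
      intro q hq0
      apply connectedComponentIn_eq_empty
      rcases mul_eq_zero.mp hq0 with h | h
      · simp [sub_eq_zero.mp h]
      · simp [sub_eq_zero.mp h]
    rw [empty _ h₁, empty _ h₂, h₁]
    simp
  · exact connectedComponentIn_ne_iff hp h₁ (fun h => h₁ (hcommon.mpr h))

/-! ### Fixed points of hyperbolic elements -/

lemma entry_10_ne_zero {g : SL2Z} (hg : 2 < |tr g|) : g.1 1 0 ≠ 0 := by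
  intro h
  have hd := det_entries g
  rw [h, mul_zero, sub_zero] at hd
  rcases Int.eq_one_or_neg_one_of_mul_eq_one' hd with ⟨h1, h2⟩ | ⟨h1, h2⟩ <;>
    simp only [tr, h1, h2] at hg <;> norm_num at hg

lemma two_lt_abs_iff (t : ℤ) : 2 < |t| ↔ 4 < t ^ 2 := by
  rw [show (4 : ℤ) = 2 ^ 2 by norm_num, sq_lt_sq]; simp

lemma mem_fixedSet_iff {g : SL2Z} (hg : 2 < |tr g|) (p : OnePoint ℝ) :
    p ∈ fixedSet g ↔ ∃ x : ℝ, p = (x : OnePoint ℝ) ∧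
      entry g 1 0 * x ^ 2 + (entry g 1 1 - entry g 0 0) * x - entry g 0 1 = 0 := by
  have hc : entry g 1 0 ≠ 0 := by
    simpa [entry] using entry_10_ne_zero hg
  have hdet : entry g 0 0 * entry g 1 1 - entry g 0 1 * entry g 1 0 = 1 := by
    have := det_entries g
    simp only [entry]; exact_mod_cast this
  induction p using OnePoint.rec with
  | infty =>
    constructor
    · intro h
      have h' : (if entry g 1 0 = 0 then OnePoint.infty
        else OnePoint.some (entry g 0 0 / entry g 1 0)) = (OnePoint.infty : OnePoint ℝ) := h
      rw [if_neg hc] at h'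
      exact absurd h' (OnePoint.coe_ne_infty _)
    · rintro ⟨x, hx, -⟩
      exact absurd hx (OnePoint.infty_ne_coe _)
  | coe x =>
    have hmem : (x : OnePoint ℝ) ∈ fixedSet g ↔
        (if entry g 1 0 * x + entry g 1 1 = 0 then OnePoint.infty
      else OnePoint.some ((entry g 0 0 * x + entry g 0 1) / (entry g 1 0 * x + entry g 1 1))) =
        (x : OnePoint ℝ) := Iff.rfl
    have hex : (∃ y : ℝ, (x : OnePoint ℝ) = (y : OnePoint ℝ) ∧
      entry g 1 0 * y ^ 2 + (entry g 1 1 - entry g 0 0) * y - entry g 0 1 = 0) ↔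
      entry g 1 0 * x ^ 2 + (entry g 1 1 - entry g 0 0) * x - entry g 0 1 = 0 := by
      constructor
      · rintro ⟨y, hy, h⟩
        rw [OnePoint.coe_eq_coe] at hy
        rwa [hy]
      · intro h; exact ⟨x, rfl, h⟩
    rw [hmem, hex]
    split_ifs with h0
    · refine ⟨fun h => absurd h (OnePoint.infty_ne_coe _), fun h => ?_⟩
      exfalso
      have : (1 : ℝ) = 0 := by
        linear_combination (entry g 1 0) * h + (entry g 0 0 - entry g 1 0 * x) * h0 - hdet
      exact one_ne_zero this
    · refine (OnePoint.coe_eq_coe).trans ?_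
      rw [div_eq_iff h0]
      constructor <;> intro h <;> linear_combination -h

lemma not_isSquare_disc {t : ℤ} (ht : 2 < |t|) (r : ℚ) : r ^ 2 ≠ ((t ^ 2 - 4 : ℤ) : ℚ) := by
  intro h
  have hsq : IsSquare ((t ^ 2 - 4 : ℤ) : ℚ) := ⟨r, by rw [← h]; ring⟩
  rw [Rat.isSquare_intCast_iff] at hsq
  obtain ⟨s, hs⟩ := hsq
  have h1 : |s| * |s| = |t| * |t| - 4 := by
    rw [abs_mul_abs_self, abs_mul_abs_self]; linarith
  have h2 := abs_nonneg s
  rcases le_or_gt |t| |s| with h3 | h3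
  · nlinarith
  · have h4 : |s| ≤ |t| - 1 := by omega
    nlinarith [mul_le_mul h4 h4 h2 (by omega)]

/-- The fixed points of a hyperbolic element are irrational. -/
lemma quadratic_root_irrational {g : SL2Z} (hg : 2 < |tr g|) {x : ℝ}
    (hx : entry g 1 0 * x ^ 2 + (entry g 1 1 - entry g 0 0) * x - entry g 0 1 = 0)
    {u v : ℤ} (huv : (u : ℝ) * x = v) : u = 0 := by
  by_contra hu
  have hx' : x = ((v / u : ℚ) : ℝ) := by
    push_cast
    rw [eq_div_iff (by exact_mod_cast hu)]; linarith
  refine not_isSquare_disc hg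
    (2 * g.1 1 0 * (v / u : ℚ) + (g.1 1 1 - g.1 0 0)) ?_
  have hd : entry g 0 0 * entry g 1 1 - entry g 0 1 * entry g 1 0 = 1 := by
    have := det_entries g
    simp only [entry]; exact_mod_cast this
  have : (2 * entry g 1 0 * x + (entry g 1 1 - entry g 0 0)) ^ 2 =
      (entry g 0 0 + entry g 1 1) ^ 2 - 4 := by
    linear_combination (4 * entry g 1 0) * hx - 4 * hd
  rw [hx'] at this
  simp only [entry, tr] at this ⊢
  exact_mod_cast this

lemma exists_fixed_points {g : SL2Z} (hg : 2 < |tr g|) : ∃ p₁ p₂ : ℝ, p₁ < p₂ ∧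
    fixedSet g = {(p₁ : OnePoint ℝ), (p₂ : OnePoint ℝ)} ∧
    (∀ x : ℝ, entry g 1 0 * x ^ 2 + (entry g 1 1 - entry g 0 0) * x - entry g 0 1 =
      entry g 1 0 * ((x - p₁) * (x - p₂))) := by
  have hc : entry g 1 0 ≠ 0 := by
    simpa [entry] using entry_10_ne_zero hg
  have hdet : entry g 0 0 * entry g 1 1 - entry g 0 1 * entry g 1 0 = 1 := by
    have := det_entries g
    simp only [entry]; exact_mod_cast this
  have hD : 0 < (entry g 0 0 + entry g 1 1) ^ 2 - 4 := by
    rw [two_lt_abs_iff] at hg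
    simp only [entry]
    have : (0 : ℤ) < (g.1 0 0 + g.1 1 1) ^ 2 - 4 := by simp only [tr] at hg; linarith
    exact_mod_cast this
  have main : ∃ p₁ p₂ : ℝ, p₁ < p₂ ∧
    (∀ x : ℝ, entry g 1 0 * x ^ 2 + (entry g 1 1 - entry g 0 0) * x - entry g 0 1 =
      entry g 1 0 * ((x - p₁) * (x - p₂))) := by
    set s := √((entry g 0 0 + entry g 1 1) ^ 2 - 4) with hs
    have hs2 : s ^ 2 = (entry g 0 0 + entry g 1 1) ^ 2 - 4 := Real.sq_sqrt hD.le
    have hspos : 0 < s := Real.sqrt_pos.mpr hD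
    set m := (entry g 0 0 - entry g 1 1) / (2 * entry g 1 0) with hm
    set q := s / (2 * entry g 1 0) with hq
    have hmc : 2 * entry g 1 0 * m = entry g 0 0 - entry g 1 1 := by
      rw [hm]; field_simp
    have hqc : 2 * entry g 1 0 * q = s := by rw [hq]; field_simp
    have hq0 : q ≠ 0 := by rw [hq]; positivity
    have e : ∀ x : ℝ, entry g 1 0 * x ^ 2 + (entry g 1 1 - entry g 0 0) * x - entry g 0 1 =
      entry g 1 0 * ((x - m) ^ 2 - |q| ^ 2) := by
      intro x
      rw [sq_abs]
      apply mul_left_cancel₀ (mul_ne_zero (by norm_num : (4 : ℝ) ≠ 0) hc)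
      linear_combination (4 * entry g 1 0 * x - 2 * entry g 1 0 * m -
        (entry g 0 0 - entry g 1 1)) * hmc + (2 * entry g 1 0 * q + s) * hqc + hs2 + 4 * hdet
    refine ⟨m - |q|, m + |q|, by linarith [abs_pos.mpr hq0], fun x => ?_⟩
    rw [e]; ring
  obtain ⟨p₁, p₂, hlt, hfac⟩ := main
  refine ⟨p₁, p₂, hlt, ?_, hfac⟩
  ext p
  rw [mem_fixedSet_iff hg]
  simp only [hfac, mul_eq_zero, hc, false_or, sub_eq_zero, Set.mem_insert_iff,
    Set.mem_singleton_iff]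
  constructor
  · rintro ⟨x, rfl, rfl | rfl⟩ <;> simp
  · rintro (rfl | rfl)
    · exact ⟨_, rfl, Or.inl rfl⟩
    · exact ⟨_, rfl, Or.inr rfl⟩

/-- Two hyperbolic elements with a common fixed point have proportional quadratics. -/
lemma common_fixed_point {g g' : SL2Z} (hg : 2 < |tr g|) {x y : ℝ}
    (hx : entry g 1 0 * x ^ 2 + (entry g 1 1 - entry g 0 0) * x - entry g 0 1 = 0)
    (hx' : entry g' 1 0 * x ^ 2 + (entry g' 1 1 - entry g' 0 0) * x - entry g' 0 1 = 0)
    (hy : entry g' 1 0 * y ^ 2 + (entry g' 1 1 - entry g' 0 0) * y - entry g' 0 1 = 0) :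
    entry g 1 0 * y ^ 2 + (entry g 1 1 - entry g 0 0) * y - entry g 0 1 = 0 ∨
      g'.1 1 0 = 0 := by
  have h1 : ((g'.1 1 0 * (g.1 1 1 - g.1 0 0) - g.1 1 0 * (g'.1 1 1 - g'.1 0 0) : ℤ) : ℝ) * x
      = ((g'.1 1 0 * g.1 0 1 - g.1 1 0 * g'.1 0 1 : ℤ) : ℝ) := by
    simp only [entry] at hx hx'
    push_cast
    linear_combination (g'.1 1 0 : ℝ) * hx - (g.1 1 0 : ℝ) * hx'
  have h2 := quadratic_root_irrational hg hx h1
  rw [h2, Int.cast_zero, zero_mul] at h1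
  have h3 := h1.symm
  have h2' : ((g'.1 1 0 * (g.1 1 1 - g.1 0 0) - g.1 1 0 * (g'.1 1 1 - g'.1 0 0) : ℤ) : ℝ) = 0 := by
    exact_mod_cast h2
  push_cast at h3 h2'
  by_cases hc : g'.1 1 0 = 0
  · exact Or.inr hc
  · left
    have hc' : (g'.1 1 0 : ℝ) ≠ 0 := by exact_mod_cast hc
    apply mul_left_cancel₀ hc'
    simp only [entry] at hy ⊢
    linear_combination (g.1 1 0 : ℝ) * hy + y * h2' - h3

lemma mul_sub_neg_iff {T a b : ℝ} (hab : a < b) :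
    4 * ((T - a) * (T - b)) < 0 ↔ a < T ∧ T < b := by
  constructor
  · intro h
    constructor <;> nlinarith
  · rintro ⟨h1, h2⟩
    nlinarith [mul_pos (sub_pos.mpr h1) (sub_pos.mpr h2)]

/-- Linking of the fixed-point sets is detected by traces. -/
lemma linked_iff_crosses {g h : SL2Z} (hg : 2 < |tr g|) :
    Linked (fixedSet g) (fixedSet (h * g * h⁻¹)) ↔ Crosses g h := by
  unfold Crosses
  have htr : tr (h * g * h⁻¹) = tr g := tr_conj g h
  generalize h * g * h⁻¹ = g' at htr ⊢
  have hg' : 2 < |tr g'| := by rw [htr]; exact hg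
  obtain ⟨p₁, p₂, hp, hfix, hfac⟩ := exists_fixed_points hg
  obtain ⟨q₁, q₂, hq, hfix', hfac'⟩ := exists_fixed_points hg'
  have hc : entry g 1 0 ≠ 0 := by simpa [entry] using entry_10_ne_zero hg
  have hc0' := entry_10_ne_zero hg'
  have hc' : entry g' 1 0 ≠ 0 := by simpa [entry] using hc0'
  have root : ∀ x : ℝ, (x - p₁) * (x - p₂) = 0 ↔
      entry g 1 0 * x ^ 2 + (entry g 1 1 - entry g 0 0) * x - entry g 0 1 = 0 := by
    intro x; rw [hfac]; simp [hc]
  have hq₁ : entry g' 1 0 * q₁ ^ 2 + (entry g' 1 1 - entry g' 0 0) * q₁ - entry g' 0 1 = 0 := by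
    rw [hfac']; ring
  have hq₂ : entry g' 1 0 * q₂ ^ 2 + (entry g' 1 1 - entry g' 0 0) * q₂ - entry g' 0 1 = 0 := by
    rw [hfac']; ring
  rw [hfix, hfix', linked_pair_iff hp hq.ne]
  · have e0 := hfac 0
    have e1 := hfac 1
    have f0 := hfac' 0
    have f1 := hfac' 1
    have hb : entry g 0 1 = - (entry g 1 0 * (p₁ * p₂)) := by linear_combination -e0
    have hb' : entry g' 0 1 = - (entry g' 1 0 * (q₁ * q₂)) := by linear_combination -f0
    have he : entry g 0 0 - entry g 1 1 = entry g 1 0 * (p₁ + p₂) := by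
      linear_combination e0 - e1
    have he' : entry g' 0 0 - entry g' 1 1 = entry g' 1 0 * (q₁ + q₂) := by
      linear_combination f0 - f1
    have hdet : entry g 0 0 * entry g 1 1 - entry g 0 1 * entry g 1 0 = 1 := by
      have := det_entries g
      simp only [entry]; exact_mod_cast this
    have hdet' : entry g' 0 0 * entry g' 1 1 - entry g' 0 1 * entry g' 1 0 = 1 := by
      have := det_entries g'
      simp only [entry]; exact_mod_cast this
    have ht : entry g' 0 0 + entry g' 1 1 = entry g 0 0 + entry g 1 1 := by
      simp only [tr] at htr
      simp only [entry]; exact_mod_cast htr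
    set t := entry g 0 0 + entry g 1 1 with htdef
    have htR : ((tr g : ℤ) : ℝ) = t := by simp [tr, entry, htdef]
    set T : ℝ := ((tr (g * g') : ℤ) : ℝ) with hT
    have hT' : T = entry g 0 0 * entry g' 0 0 + entry g 0 1 * entry g' 1 0 +
        (entry g 1 0 * entry g' 0 1 + entry g 1 1 * entry g' 1 1) := by
      simp [hT, tr, entry, mul_entry]
    have hD : t ^ 2 - 4 = (entry g 1 0 * (p₁ - p₂)) ^ 2 := by
      linear_combination 4 * entry g 1 0 * hb + 4 * hdet +
        (entry g 0 0 - entry g 1 1 + entry g 1 0 * (p₁ + p₂)) * he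
    have hD' : t ^ 2 - 4 = (entry g' 1 0 * (q₁ - q₂)) ^ 2 := by
      linear_combination 4 * entry g' 1 0 * hb' + 4 * hdet' +
        (entry g' 0 0 - entry g' 1 1 + entry g' 1 0 * (q₁ + q₂)) * he' -
        (entry g' 0 0 + entry g' 1 1 + t) * ht
    have hB : 2 * T - t ^ 2 = entry g 1 0 * entry g' 1 0 *
        ((p₁ + p₂) * (q₁ + q₂) - 2 * (p₁ * p₂) - 2 * (q₁ * q₂)) := by
      linear_combination 2 * hT' + 2 * entry g' 1 0 * hb + 2 * entry g 1 0 * hb' +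
        (entry g' 0 0 - entry g' 1 1) * he + entry g 1 0 * (p₁ + p₂) * he' + t * ht
    have hRes : 4 * (entry g 1 0 * entry g' 1 0) ^ 2 *
        ((q₁ - p₁) * (q₁ - p₂) * ((q₂ - p₁) * (q₂ - p₂))) =
        (2 * T - t ^ 2) ^ 2 - (t ^ 2 - 4) * (t ^ 2 - 4) := by
      rw [hB]
      nth_rewrite 1 [hD]
      rw [hD']
      ring
    have hpos : 0 < 4 * (entry g 1 0 * entry g' 1 0) ^ 2 := by positivity
    have : (q₁ - p₁) * (q₁ - p₂) * ((q₂ - p₁) * (q₂ - p₂)) < 0 ↔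
        (2 * T - t ^ 2) ^ 2 - (t ^ 2 - 4) * (t ^ 2 - 4) < 0 := by
      rw [← hRes]
      constructor
      · intro h; exact mul_neg_of_pos_of_neg hpos h
      · intro h; by_contra! h'; exact absurd h (not_lt.mpr (mul_nonneg hpos.le h'))
    rw [this]
    have ht4 : 4 < t ^ 2 := by
      rw [← htR]; rw [two_lt_abs_iff] at hg; exact_mod_cast hg
    have cast : (2 < tr (g * g') ∧ tr (g * g') < tr g ^ 2 - 2) ↔ (2 < T ∧ T < t ^ 2 - 2) := by
      rw [hT, ← htR]; norm_cast
    rw [cast, show (2 * T - t ^ 2) ^ 2 - (t ^ 2 - 4) * (t ^ 2 - 4) =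
      4 * ((T - 2) * (T - (t ^ 2 - 2))) by ring]
    exact mul_sub_neg_iff (by linarith)
  · rw [root, root]
    constructor
    · intro h; exact (common_fixed_point hg h hq₁ hq₂).resolve_right hc0'
    · intro h; exact (common_fixed_point hg h hq₂ hq₁).resolve_right hc0'

lemma goodConj_iff {v h : Gamma} :
    GoodConj v h ↔ 2 < |tr (v : SL2Z)| ∧ Crosses (v : SL2Z) (h : SL2Z) := by
  unfold GoodConj
  simp only [hyperbolic_iff_tr, Subgroup.coe_mul, Subgroup.coe_inv, tr_conj]
  constructor
  · rintro ⟨h1, -, h2⟩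
    exact ⟨h1, (linked_iff_crosses h1).mp h2⟩
  · rintro ⟨h1, h2⟩
    exact ⟨h1, h1, (linked_iff_crosses h1).mpr h2⟩

/-! ### Finiteness of the set of crossing double cosets -/

/-- The bilinear expression `(1, -p) h (q, 1)ᵀ`. -/
noncomputable def bil (p q : ℝ) (h : SL2Z) : ℝ :=
  (entry h 0 0 * q + entry h 0 1) - p * (entry h 1 0 * q + entry h 1 1)

lemma entry_mul (g h : SL2Z) (i j : Fin 2) :
    entry (g * h) i j = entry g i 0 * entry h 0 j + entry g i 1 * entry h 1 j := by
  simp [entry, mul_entry]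

lemma bil_zpow_mul {v : SL2Z} {p q l : ℝ} (hl : l ≠ 0)
    (H : ∀ h, bil p q (v * h) = l * bil p q h) (m : ℤ) (h : SL2Z) :
    bil p q (v ^ m * h) = l ^ m * bil p q h := by
  induction m with
  | zero => simp
  | succ n ih => rw [zpow_add_one, (Commute.zpow_self v n).eq, mul_assoc, H, ih,
      zpow_add_one₀ hl]; ring
  | pred n ih =>
    have := H (v ^ (-(n : ℤ) - 1) * h)
    rw [← mul_assoc, ← zpow_one_add, add_sub_cancel, ih] at this
    rw [zpow_sub_one₀ hl]
    field_simp
    linarith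

lemma bil_mul_zpow {v : SL2Z} {p q l : ℝ} (hl : l ≠ 0)
    (H : ∀ h, bil p q (h * v) = l * bil p q h) (m : ℤ) (h : SL2Z) :
    bil p q (h * v ^ m) = l ^ m * bil p q h := by
  induction m with
  | zero => simp
  | succ n ih => rw [zpow_add_one, ← mul_assoc, H, ih, zpow_add_one₀ hl]; ring
  | pred n ih =>
    have := H (h * v ^ (-(n : ℤ) - 1))
    rw [mul_assoc, ← zpow_add_one, sub_add_cancel, ih] at this
    rw [zpow_sub_one₀ hl]
    field_simp
    linarith

lemma exists_zpow_mul_mem {y : ℝ} (hy : 0 < y) (hy1 : y ≠ 1) :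
    ∃ K : ℝ, 1 ≤ K ∧ ∀ x : ℝ, 0 < x → ∃ m : ℤ, 1 ≤ y ^ m * x ∧ y ^ m * x ≤ K := by
  have main : ∀ y : ℝ, 1 < y → ∀ x : ℝ, 0 < x → ∃ m : ℤ, 1 ≤ y ^ m * x ∧ y ^ m * x ≤ y := by
    intro y hy x hx
    obtain ⟨n, hn⟩ := exists_mem_Ico_zpow hx hy
    have hpos : 0 < y ^ n := zpow_pos (by linarith) n
    refine ⟨-n, ?_, ?_⟩ <;> rw [zpow_neg, inv_mul_eq_div]
    · rw [one_le_div hpos]; exact hn.1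
    · rw [div_le_iff₀ hpos, mul_comm, ← zpow_add_one₀ (by linarith)]; exact hn.2.le
  rcases lt_or_gt_of_ne hy1 with h | h
  · have h' : 1 < y⁻¹ := (one_lt_inv₀ hy).mpr h
    refine ⟨y⁻¹, h'.le, fun x hx => ?_⟩
    obtain ⟨m, hm⟩ := main _ h' x hx
    exact ⟨-m, by rwa [zpow_neg, ← inv_zpow]⟩
  · exact ⟨y, h.le, main y h⟩

lemma abs_linear_le {a b c d u₁ u₂ u₃ u₄ M : ℝ} (h₁ : |u₁| ≤ M) (h₂ : |u₂| ≤ M) (h₃ : |u₃| ≤ M)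
    (h₄ : |u₄| ≤ M) :
    |a * u₁ + b * u₂ + c * u₃ + d * u₄| ≤ (|a| + |b| + |c| + |d|) * M := by
  have e₁ := abs_add_le (a * u₁ + b * u₂ + c * u₃) (d * u₄)
  have e₂ := abs_add_le (a * u₁ + b * u₂) (c * u₃)
  have e₃ := abs_add_le (a * u₁) (b * u₂)
  rw [abs_mul] at e₁ e₂ e₃
  rw [abs_mul b] at e₃
  have f₁ := mul_le_mul_of_nonneg_left h₁ (abs_nonneg a)
  have f₂ := mul_le_mul_of_nonneg_left h₂ (abs_nonneg b)
  have f₃ := mul_le_mul_of_nonneg_left h₃ (abs_nonneg c)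
  have f₄ := mul_le_mul_of_nonneg_left h₄ (abs_nonneg d)
  linarith

lemma finite_of_entry_bound (K : ℝ) : {h : SL2Z | ∀ i j, |entry h i j| ≤ K}.Finite := by
  have hfin : (Set.pi Set.univ fun _ : Fin 2 =>
      (Set.pi Set.univ fun _ : Fin 2 => Set.Icc (-⌈K⌉) ⌈K⌉)).Finite :=
    Set.Finite.pi fun _ => Set.Finite.pi fun _ => Set.finite_Icc _ _
  refine Set.Finite.of_finite_image (f := fun h : SL2Z => fun i j => h.1 i j)
    (hfin.subset ?_) ?_
  · rintro _ ⟨h, hh, rfl⟩ i - j -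
    have h1 := abs_le.mp (hh i j)
    have h2 := Int.le_ceil K
    simp only [entry] at h1
    constructor
    · have : ((-⌈K⌉ : ℤ) : ℝ) ≤ h.1 i j := by push_cast; linarith
      exact_mod_cast this
    · have : (h.1 i j : ℝ) ≤ ((⌈K⌉ : ℤ) : ℝ) := by linarith
      exact_mod_cast this
  · intro g _ h _ e
    have e' : ∀ i j, g.1 i j = h.1 i j := fun i j => congrFun (congrFun e i) j
    exact SL2Z_ext (e' _ _) (e' _ _) (e' _ _) (e' _ _)

lemma finite_of_bil_bound {p₁ p₂ : ℝ} (hp : p₁ < p₂) (M : ℝ) :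
    {h : SL2Z | |bil p₂ p₁ h| ≤ M ∧ |bil p₂ p₂ h| ≤ M ∧ |bil p₁ p₁ h| ≤ M ∧
      |bil p₁ p₂ h| ≤ M}.Finite := by
  have hd : (p₁ - p₂) ^ 2 ≠ 0 := pow_ne_zero _ (by linarith)
  obtain ⟨δ, hδ⟩ : ∃ δ : ℝ, δ * (p₁ - p₂) ^ 2 = 1 := ⟨_, inv_mul_cancel₀ hd⟩
  set S : ℝ := (|δ * 1| + |δ * (-1)| + |δ * (-1)| + |δ * 1|) +
    (|δ * (-p₂)| + |δ * p₁| + |δ * p₂| + |δ * (-p₁)|) +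
    (|δ * p₁| + |δ * (-p₁)| + |δ * (-p₂)| + |δ * p₂|) +
    (|δ * (-(p₁ * p₂))| + |δ * p₁ ^ 2| + |δ * p₂ ^ 2| + |δ * (-(p₁ * p₂))|) with hS
  refine (finite_of_entry_bound (S * M)).subset ?_
  rintro h ⟨h₁, h₂, h₃, h₄⟩ i j
  have hM : 0 ≤ M := (abs_nonneg _).trans h₁
  have e10 : entry h 1 0 = δ * 1 * bil p₂ p₁ h + δ * (-1) * bil p₂ p₂ h +
      δ * (-1) * bil p₁ p₁ h + δ * 1 * bil p₁ p₂ h := by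
    simp only [bil]; linear_combination (-entry h 1 0) * hδ
  have e11 : entry h 1 1 = δ * (-p₂) * bil p₂ p₁ h + δ * p₁ * bil p₂ p₂ h +
      δ * p₂ * bil p₁ p₁ h + δ * (-p₁) * bil p₁ p₂ h := by
    simp only [bil]; linear_combination (-entry h 1 1) * hδ
  have e00 : entry h 0 0 = δ * p₁ * bil p₂ p₁ h + δ * (-p₁) * bil p₂ p₂ h +
      δ * (-p₂) * bil p₁ p₁ h + δ * p₂ * bil p₁ p₂ h := by
    simp only [bil]; linear_combination (-entry h 0 0) * hδ
  have e01 : entry h 0 1 = δ * (-(p₁ * p₂)) * bil p₂ p₁ h + δ * p₁ ^ 2 * bil p₂ p₂ h +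
      δ * p₂ ^ 2 * bil p₁ p₁ h + δ * (-(p₁ * p₂)) * bil p₁ p₂ h := by
    simp only [bil]; linear_combination (-entry h 0 1) * hδ
  have fin : ∀ {x s : ℝ}, |x| ≤ s * M → s ≤ S → |x| ≤ S * M := fun h1 h2 =>
    h1.trans (mul_le_mul_of_nonneg_right h2 hM)
  have nn := fun a : ℝ => abs_nonneg (δ * a)
  have f00 : |entry h 0 0| ≤ S * M := by
    rw [e00]
    refine fin (abs_linear_le h₁ h₂ h₃ h₄) ?_
    rw [hS]
    linarith [nn 1, nn (-1), nn p₁, nn (-p₁), nn p₂, nn (-p₂), nn (p₁ ^ 2), nn (p₂ ^ 2),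
      nn (-(p₁ * p₂))]
  have f01 : |entry h 0 1| ≤ S * M := by
    rw [e01]
    refine fin (abs_linear_le h₁ h₂ h₃ h₄) ?_
    rw [hS]
    linarith [nn 1, nn (-1), nn p₁, nn (-p₁), nn p₂, nn (-p₂), nn (p₁ ^ 2), nn (p₂ ^ 2),
      nn (-(p₁ * p₂))]
  have f10 : |entry h 1 0| ≤ S * M := by
    rw [e10]
    refine fin (abs_linear_le h₁ h₂ h₃ h₄) ?_
    rw [hS]
    linarith [nn 1, nn (-1), nn p₁, nn (-p₁), nn p₂, nn (-p₂), nn (p₁ ^ 2), nn (p₂ ^ 2),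
      nn (-(p₁ * p₂))]
  have f11 : |entry h 1 1| ≤ S * M := by
    rw [e11]
    refine fin (abs_linear_le h₁ h₂ h₃ h₄) ?_
    rw [hS]
    linarith [nn 1, nn (-1), nn p₁, nn (-p₁), nn p₂, nn (-p₂), nn (p₁ ^ 2), nn (p₂ ^ 2),
      nn (-(p₁ * p₂))]
  fin_cases i <;> fin_cases j <;> assumption

/-- Size bounds on four reals with controlled products. -/
lemma abs_le_of_products {x y z w P Q a b K D : ℝ} (hx : x * w = -a) (hy : y * z = b)
    (ha : 1 ≤ a) (haD : a ≤ D) (hb : 1 ≤ b) (hbD : b ≤ D) (hP : |x * y| = P) (hQ : |x * z| = Q)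
    (hP1 : 1 ≤ P) (hPK : P ≤ K) (hQ1 : 1 ≤ Q) (hQK : Q ≤ K) :
    |x| ≤ K ^ 2 + D ^ 3 + D * K ∧ |y| ≤ K ^ 2 + D ^ 3 + D * K ∧
    |z| ≤ K ^ 2 + D ^ 3 + D * K ∧ |w| ≤ K ^ 2 + D ^ 3 + D * K := by
  have hK : 1 ≤ K := hP1.trans hPK
  have hD : 1 ≤ D := ha.trans haD
  have hx' : |x| * |w| = a := by rw [← abs_mul, hx, abs_neg, abs_of_pos (by linarith)]
  have hy' : |y| * |z| = b := by rw [← abs_mul, hy, abs_of_pos (by linarith)]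
  rw [abs_mul] at hP hQ
  have nx := abs_nonneg x
  have ny := abs_nonneg y
  have nz := abs_nonneg z
  have nw := abs_nonneg w
  generalize |x| = x at *
  generalize |y| = y at *
  generalize |z| = z at *
  generalize |w| = w at *
  have key : ∀ s t : ℝ, 0 ≤ s → 1 ≤ t → s ^ 2 ≤ t → s ≤ t := by
    intro s t hs ht h
    nlinarith
  have sx : x ^ 2 * b = P * Q := by rw [← hP, ← hQ, ← hy']; ring
  have sy : y ^ 2 * Q = b * P := by rw [← hP, ← hQ, ← hy']; ring
  have sz : z ^ 2 * P = b * Q := by rw [← hP, ← hQ, ← hy']; ring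
  have sw : w ^ 2 * (P * Q) = a ^ 2 * b := by rw [← hP, ← hQ, ← hy', ← hx']; ring
  have PQ : P * Q ≤ K ^ 2 := by nlinarith
  have PQ1 : 1 ≤ P * Q := by nlinarith
  have bP : b * P ≤ D * K := mul_le_mul hbD hPK (by linarith) (by linarith)
  have bQ : b * Q ≤ D * K := mul_le_mul hbD hQK (by linarith) (by linarith)
  have ab : a ^ 2 * b ≤ D ^ 3 := by
    have : a ^ 2 ≤ D ^ 2 := pow_le_pow_left₀ (by linarith) haD 2
    calc a ^ 2 * b ≤ D ^ 2 * D := mul_le_mul this hbD (by linarith) (by positivity)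
      _ = D ^ 3 := by ring
  have K2 : 1 ≤ K ^ 2 := one_le_pow₀ hK
  have D3 : 1 ≤ D ^ 3 := one_le_pow₀ hD
  have DK : 1 ≤ D * K := by nlinarith
  refine ⟨key _ _ nx (by linarith) ?_, key _ _ ny (by linarith) ?_, key _ _ nz (by linarith) ?_,
    key _ _ nw (by linarith) ?_⟩
  · have := le_mul_of_one_le_right (sq_nonneg x) hb
    linarith
  · have := le_mul_of_one_le_right (sq_nonneg y) hQ1
    linarith
  · have := le_mul_of_one_le_right (sq_nonneg z) hP1
    linarith
  · have := le_mul_of_one_le_right (sq_nonneg w) PQ1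
    linarith

/-- Up to the two-sided action of `⟨v⟩` there are finitely many crossing conjugators. -/
lemma exists_finite_reps {v : SL2Z} (hv : 2 < |tr v|) : ∃ S : Set SL2Z, S.Finite ∧
    ∀ h, Crosses v h → ∃ m k : ℤ, v ^ m * h * v ^ k ∈ S := by
  obtain ⟨p₁, p₂, hp, -, hfac⟩ := exists_fixed_points hv
  have hc : entry v 1 0 ≠ 0 := by simpa [entry] using entry_10_ne_zero hv
  have hdet : entry v 0 0 * entry v 1 1 - entry v 0 1 * entry v 1 0 = 1 := by
    have := det_entries v
    simp only [entry]; exact_mod_cast this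
  have e0 := hfac 0
  have e1 := hfac 1
  have hb : entry v 0 1 = - (entry v 1 0 * (p₁ * p₂)) := by linear_combination -e0
  have he : entry v 0 0 = entry v 1 1 + entry v 1 0 * (p₁ + p₂) := by
    linear_combination e0 - e1
  set c := entry v 1 0 with hcdef
  set d := entry v 1 1 with hddef
  set l₁ := c * p₁ + d with hl₁
  set l₂ := c * p₂ + d with hl₂
  have hll : l₁ * l₂ = 1 := by
    rw [hl₁, hl₂]; linear_combination hdet - d * he + c * hb
  have hl₁0 : l₁ ≠ 0 := left_ne_zero_of_mul_eq_one hll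
  have hl₂0 : l₂ ≠ 0 := right_ne_zero_of_mul_eq_one hll
  have hll' : ∀ m : ℤ, l₁ ^ m * l₂ ^ m = 1 := fun m => by rw [← mul_zpow, hll, one_zpow]
  have htr : ((tr v : ℤ) : ℝ) = l₁ + l₂ := by
    have : ((tr v : ℤ) : ℝ) = entry v 0 0 + d := by simp [tr, entry, hddef]
    rw [this, he]; ring
  have hD : ((tr v : ℤ) : ℝ) ^ 2 - 4 = (c * (p₁ - p₂)) ^ 2 := by
    rw [htr]
    linear_combination 4 * hll
  have hy1 : l₁ ^ 2 ≠ 1 := by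
    intro h
    have h1 : (l₁ - l₂) * l₁ = 0 := by linear_combination h - hll
    have h2 : l₁ - l₂ = 0 := (mul_eq_zero.mp h1).resolve_right hl₁0
    have h3 : c * (p₁ - p₂) = 0 := by rw [← h2, hl₁, hl₂]; ring
    rcases mul_eq_zero.mp h3 with h4 | h4
    · exact hc h4
    · linarith
  obtain ⟨K, hK, hKx⟩ := exists_zpow_mul_mem (by positivity : (0 : ℝ) < l₁ ^ 2) hy1
  have bl₁ : ∀ q h, bil p₂ q (v * h) = l₁ * bil p₂ q h := by
    intro q h
    simp only [bil, entry_mul]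
    rw [hb, he, ← hcdef, ← hddef, hl₁]; ring
  have bl₂ : ∀ q h, bil p₁ q (v * h) = l₂ * bil p₁ q h := by
    intro q h
    simp only [bil, entry_mul]
    rw [hb, he, ← hcdef, ← hddef, hl₂]; ring
  have br₁ : ∀ p h, bil p p₁ (h * v) = l₁ * bil p p₁ h := by
    intro p h
    simp only [bil, entry_mul]
    rw [hb, he, ← hcdef, ← hddef, hl₁]; ring
  have br₂ : ∀ p h, bil p p₂ (h * v) = l₂ * bil p p₂ h := by
    intro p h
    simp only [bil, entry_mul]
    rw [hb, he, ← hcdef, ← hddef, hl₂]; ring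
  set D : ℝ := ((tr v ^ 2 - 4 : ℤ) : ℝ) with hDdef
  set M : ℝ := (K ^ 2 + D ^ 3 + D * K) / |c|
  refine ⟨_, finite_of_bil_bound hp M, fun h hh => ?_⟩
  set T := tr (v * (h * v * h⁻¹)) with hT
  have hhdet : entry h 0 0 * entry h 1 1 - entry h 0 1 * entry h 1 0 = 1 := by
    have := det_entries h
    simp only [entry]; exact_mod_cast this
  have hprod : bil p₂ p₁ h * bil p₁ p₂ h - bil p₂ p₂ h * bil p₁ p₁ h = -(p₁ - p₂) ^ 2 := by
    simp only [bil]
    linear_combination (-(p₁ - p₂) ^ 2) * hhdet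
  have hTr : (T : ℝ) = 2 - c ^ 2 * (bil p₂ p₁ h * bil p₁ p₂ h) := by
    have : (T : ℝ) = (entry v 0 0 * (entry (h * v) 0 0 * entry h 1 1 -
        entry (h * v) 0 1 * entry h 1 0) + entry v 0 1 * (entry (h * v) 1 0 * entry h 1 1 -
        entry (h * v) 1 1 * entry h 1 0)) + (c * (-entry (h * v) 0 0 * entry h 0 1 +
        entry (h * v) 0 1 * entry h 0 0) + d * (-entry (h * v) 1 0 * entry h 0 1 +
        entry (h * v) 1 1 * entry h 0 0)) := by
      rw [hT]
      simp only [tr, mul_entry v, mul_entry _ h⁻¹, inv_entry_00, inv_entry_01, inv_entry_10,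
        inv_entry_11, entry, hcdef, hddef]
      push_cast; ring
    rw [this]
    simp only [entry_mul]
    rw [← hcdef, ← hddef, hb, he]
    simp only [bil]
    have hll2 := hll
    rw [hl₁, hl₂] at hll2
    linear_combination (2 * (entry h 0 0 * entry h 1 1 - entry h 0 1 * entry h 1 0)) * hll2 +
      2 * hhdet
  have hα : (c * bil p₂ p₁ h) * (c * bil p₁ p₂ h) = -((T - 2 : ℤ) : ℝ) := by
    push_cast; linear_combination hTr
  have hβ : (c * bil p₂ p₂ h) * (c * bil p₁ p₁ h) = ((tr v ^ 2 - 2 - T : ℤ) : ℝ) := by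
    push_cast; linear_combination -c ^ 2 * hprod - hD + hTr
  have hα1 : (1 : ℝ) ≤ ((T - 2 : ℤ) : ℝ) := by
    have := hh.1; exact_mod_cast (by omega : (1 : ℤ) ≤ T - 2)
  have hβ1 : (1 : ℝ) ≤ ((tr v ^ 2 - 2 - T : ℤ) : ℝ) := by
    have := hh.2; exact_mod_cast (by omega : (1 : ℤ) ≤ tr v ^ 2 - 2 - T)
  have hsum : ((T - 2 : ℤ) : ℝ) + ((tr v ^ 2 - 2 - T : ℤ) : ℝ) = D := by
    rw [hDdef]; push_cast; ring
  have hx0 : c * bil p₂ p₁ h ≠ 0 := by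
    intro h0; rw [h0, zero_mul] at hα; linarith
  have hy0 : c * bil p₂ p₂ h ≠ 0 := by
    intro h0; rw [h0, zero_mul] at hβ; linarith
  have hz0 : c * bil p₁ p₁ h ≠ 0 := by
    intro h0; rw [h0, mul_zero] at hβ; linarith
  obtain ⟨m, hm1, hm2⟩ := hKx |(c * bil p₂ p₁ h) * (c * bil p₂ p₂ h)|
    (abs_pos.mpr (mul_ne_zero hx0 hy0))
  obtain ⟨k, hk1, hk2⟩ := hKx |(c * bil p₂ p₁ h) * (c * bil p₁ p₁ h)|
    (abs_pos.mpr (mul_ne_zero hx0 hz0))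
  refine ⟨m, k, ?_⟩
  set h' := v ^ m * h * v ^ k with hh'
  have E11 : bil p₂ p₁ h' = l₁ ^ m * l₁ ^ k * bil p₂ p₁ h := by
    rw [hh', bil_mul_zpow hl₁0 (br₁ _), bil_zpow_mul hl₁0 (bl₁ _)]; ring
  have E12 : bil p₂ p₂ h' = l₁ ^ m * l₂ ^ k * bil p₂ p₂ h := by
    rw [hh', bil_mul_zpow hl₂0 (br₂ _), bil_zpow_mul hl₁0 (bl₁ _)]; ring
  have E21 : bil p₁ p₁ h' = l₂ ^ m * l₁ ^ k * bil p₁ p₁ h := by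
    rw [hh', bil_mul_zpow hl₁0 (br₁ _), bil_zpow_mul hl₂0 (bl₂ _)]; ring
  have E22 : bil p₁ p₂ h' = l₂ ^ m * l₂ ^ k * bil p₁ p₂ h := by
    rw [hh', bil_mul_zpow hl₂0 (br₂ _), bil_zpow_mul hl₂0 (bl₂ _)]; ring
  have sqz : ∀ m : ℤ, (l₁ ^ 2) ^ m = l₁ ^ m * l₁ ^ m := fun m => by rw [sq, mul_zpow]
  have sqp : ∀ m : ℤ, |l₁ ^ m * l₁ ^ m| = (l₁ ^ 2) ^ m := fun m => by
    rw [sqz, abs_of_nonneg (mul_self_nonneg _)]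
  have fin := abs_le_of_products (x := c * bil p₂ p₁ h') (y := c * bil p₂ p₂ h')
    (z := c * bil p₁ p₁ h') (w := c * bil p₁ p₂ h') (a := ((T - 2 : ℤ) : ℝ))
    (b := ((tr v ^ 2 - 2 - T : ℤ) : ℝ)) (K := K) (D := D)
    (by rw [← hα, E11, E22]
        linear_combination (c * bil p₂ p₁ h * (c * bil p₁ p₂ h)) *
          (l₁ ^ k * l₂ ^ k * hll' m + hll' k))
    (by rw [← hβ, E12, E21]
        linear_combination (c * bil p₂ p₂ h * (c * bil p₁ p₁ h)) *
          (l₁ ^ k * l₂ ^ k * hll' m + hll' k))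
    hα1 (by linarith) hβ1 (by linarith)
    (P := (l₁ ^ 2) ^ m * |(c * bil p₂ p₁ h) * (c * bil p₂ p₂ h)|)
    (Q := (l₁ ^ 2) ^ k * |(c * bil p₂ p₁ h) * (c * bil p₁ p₁ h)|)
    (by rw [← sqp, ← abs_mul, E11, E12]; congr 1
        linear_combination (l₁ ^ m * l₁ ^ m * (c * bil p₂ p₁ h) * (c * bil p₂ p₂ h)) * hll' k)
    (by rw [← sqp, ← abs_mul, E11, E21]; congr 1
        linear_combination (l₁ ^ k * l₁ ^ k * (c * bil p₂ p₁ h) * (c * bil p₁ p₁ h)) * hll' m)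
    hm1 hm2 hk1 hk2
  simp only [abs_mul] at fin
  have hcpos : 0 < |c| := abs_pos.mpr hc
  simp only [Set.mem_ofPred_eq]
  refine ⟨?_, ?_, ?_, ?_⟩ <;> rw [le_div_iff₀ hcpos, mul_comm]
  exacts [fin.1, fin.2.1, fin.2.2.1, fin.2.2.2]

/-! ### Counting crossing double cosets -/

lemma doubleCoset_equivalence (v : Gamma) : Equivalence
    (fun h h' : {h : Gamma // GoodConj v h} =>
      ∃ m k : ℤ, (h' : Gamma) = v ^ m * (h : Gamma) * v ^ k) where
  refl h := ⟨0, 0, by simp⟩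
  symm := by
    rintro h h' ⟨m, k, e⟩
    exact ⟨-m, -k, by rw [e]; group⟩
  trans := by
    rintro h h' h'' ⟨m, k, e⟩ ⟨m', k', e'⟩
    exact ⟨m' + m, k + k', by rw [e', e, zpow_add, zpow_add]; group⟩

lemma doubleCoset_mk_eq {v : Gamma} {h h' : {h : Gamma // GoodConj v h}}
    (e : Quot.mk (fun h h' : {h : Gamma // GoodConj v h} =>
      ∃ m k : ℤ, (h' : Gamma) = v ^ m * (h : Gamma) * v ^ k) h = Quot.mk _ h') :
    ∃ m k : ℤ, (h' : Gamma) = v ^ m * (h : Gamma) * v ^ k :=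
  ((doubleCoset_equivalence v).quot_mk_eq_iff h h').mp e

lemma finite_doubleCosets {v : Gamma} (hv : 2 < |tr (v : SL2Z)|) :
    Finite (Quot (fun h h' : {h : Gamma // GoodConj v h} =>
      ∃ m k : ℤ, (h' : Gamma) = v ^ m * (h : Gamma) * v ^ k)) := by
  obtain ⟨S, hS, hrep⟩ := exists_finite_reps hv
  have := hS.to_subtype
  choose m k hmk using fun q : Quot (fun h h' : {h : Gamma // GoodConj v h} =>
      ∃ m k : ℤ, (h' : Gamma) = v ^ m * (h : Gamma) * v ^ k) =>
    hrep (q.out : Gamma) (goodConj_iff.mp q.out.2).2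
  refine Finite.of_injective (β := S) (fun q => ⟨_, hmk q⟩) fun q q' e => ?_
  have e' : v ^ m q * (q.out : Gamma) * v ^ k q = v ^ m q' * (q'.out : Gamma) * v ^ k q' := by
    apply Subtype.ext
    simpa using congrArg Subtype.val e
  rw [← Quot.out_eq q, ← Quot.out_eq q']
  refine Quot.sound ⟨-m q' + m q, k q - k q', ?_⟩
  have : (q'.out : Gamma) = v ^ (-m q') * (v ^ m q' * (q'.out : Gamma) * v ^ k q') *
      v ^ (-k q') := by group
  rw [this, ← e']
  group

lemma two_dvd_sTwo {v : Gamma} (hv : 2 < |tr (v : SL2Z)|) : 2 ∣ sTwo v := by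
  have := finite_doubleCosets hv
  unfold sTwo
  set X := Quot (fun h h' : {h : Gamma // GoodConj v h} =>
      ∃ m k : ℤ, (h' : Gamma) = v ^ m * (h : Gamma) * v ^ k) with hX
  have : Fintype X := Fintype.ofFinite X
  have good_inv : ∀ h : {h : Gamma // GoodConj v h}, GoodConj v (h : Gamma)⁻¹ := fun h =>
    goodConj_iff.mpr ⟨hv, by simpa using (goodConj_iff.mp h.2).2.inv⟩
  let f : X → X := Quot.map (fun h => ⟨(h : Gamma)⁻¹, good_inv h⟩) (by
    rintro h h' ⟨m, k, e⟩
    exact ⟨-k, -m, by simp only [e]; group⟩)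
  have hf : Function.Involutive f := by
    rintro ⟨h⟩
    exact congrArg (Quot.mk _) (Subtype.ext (inv_inv (h : Gamma)))
  have hne : ∀ q, f q ≠ q := by
    rintro ⟨h⟩ e
    obtain ⟨m, k, e'⟩ := doubleCoset_mk_eq e.symm
    have e'' : (h : Gamma)⁻¹ = v ^ m * (h : Gamma) * v ^ k := e'
    have hsq : ((h : Gamma) : SL2Z) * (v : SL2Z) ^ m * (((h : Gamma) : SL2Z) * (v : SL2Z) ^ m) =
        (v : SL2Z) ^ (m - k) := by
      have : (h : Gamma) * v ^ m * ((h : Gamma) * v ^ m) = v ^ (m - k) := by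
        have h2 : v ^ m * (h : Gamma) = (h : Gamma)⁻¹ * v ^ (-k) := by rw [e'']; group
        rw [mul_assoc, ← mul_assoc (v ^ m), h2, mul_assoc (_)⁻¹, mul_inv_cancel_left, ← zpow_add]
        congr 1; ring
      simpa using congrArg Subtype.val this
    refine not_crosses_of_sq_eq_zpow hsq ?_
    have := Crosses.of_commute (Commute.one_left (v : SL2Z))
      ((Commute.refl (v : SL2Z)).zpow_left m) (goodConj_iff.mp h.2).2
    simpa using this
  have h2 := Equiv.Perm.two_dvd_card_support (σ := hf.toPerm) (by
    ext q
    rw [sq, Equiv.Perm.mul_apply]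
    exact hf q)
  have hsupp : hf.toPerm.support = Finset.univ := by
    ext q
    simpa using hne q
  rw [hsupp, Finset.card_univ] at h2
  rwa [Nat.card_eq_fintype_card]

/-! ### Powers -/

lemma pow_eq_linear (v : SL2Z) (k : ℕ) : ∃ α β : ℤ, (v ^ k).1 0 0 = α * v.1 0 0 + β ∧
    (v ^ k).1 0 1 = α * v.1 0 1 ∧ (v ^ k).1 1 0 = α * v.1 1 0 ∧
    (v ^ k).1 1 1 = α * v.1 1 1 + β := by
  induction k with
  | zero => exact ⟨0, 1, by simp⟩
  | succ k ih =>
    obtain ⟨α, β, h00, h01, h10, h11⟩ := ih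
    have hd := det_entries v
    refine ⟨α * tr v + β, -α, ?_, ?_, ?_, ?_⟩ <;>
      rw [pow_succ, mul_entry] <;> simp only [h00, h01, h10, h11, tr]
    · linear_combination (-α) * hd
    · ring
    · ring
    · linear_combination (-α) * hd

lemma crosses_of_pow {v g : SL2Z} {k : ℕ} (hgv : g = v ^ k) :
    (2 < |tr g| → 2 < |tr v|) ∧ (2 < |tr g| → ∀ h, Crosses g h → Crosses v h) := by
  obtain ⟨α, β, h00, h01, h10, h11⟩ := pow_eq_linear v k
  rw [← hgv] at h00 h01 h10 h11
  have hdv := det_entries v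
  have hdg := det_entries g
  have htr : tr g = α * tr v + 2 * β := by simp only [tr, h00, h11]; ring
  have hdet : α ^ 2 + α * β * tr v + β ^ 2 = 1 := by
    rw [h00, h01, h10, h11] at hdg
    simp only [tr]
    linear_combination hdg - α ^ 2 * hdv
  have hdisc : tr g ^ 2 - 4 = α ^ 2 * (tr v ^ 2 - 4) := by
    rw [htr]; linear_combination 4 * hdet
  have hα : 2 < |tr g| → 0 < α ^ 2 := by
    intro hg
    rw [two_lt_abs_iff] at hg
    rcases eq_or_ne α 0 with h | h
    · rw [h] at hdisc; linarith
    · positivity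
  refine ⟨fun hg => ?_, fun hg h hh => ?_⟩
  · have h0 := hα hg
    rw [two_lt_abs_iff] at hg ⊢
    have := pos_of_mul_pos_right (hdisc ▸ (by linarith) : 0 < α ^ 2 * (tr v ^ 2 - 4)) h0.le
    linarith
  · have h0 := hα hg
    have hT : tr (g * (h * g * h⁻¹)) - 2 = α ^ 2 * (tr (v * (h * v * h⁻¹)) - 2) := by
      have hdh := det_entries h
      simp only [tr] at hdet
      simp only [tr, mul_entry, inv_entry_00, inv_entry_01, inv_entry_10, inv_entry_11,
        h00, h01, h10, h11]
      linear_combination 2 * hdet + (2 * α * β * (v.1 0 0 + v.1 1 1) + 2 * β ^ 2) * hdh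
    obtain ⟨h1, h2⟩ := hh
    constructor
    · have := pos_of_mul_pos_right (hT ▸ (by linarith) :
        0 < α ^ 2 * (tr (v * (h * v * h⁻¹)) - 2)) h0.le
      linarith
    · have e : α ^ 2 * (tr v ^ 2 - 4 - (tr (v * (h * v * h⁻¹)) - 2)) =
          tr g ^ 2 - 4 - (tr (g * (h * g * h⁻¹)) - 2) := by rw [hT, hdisc]; ring
      have := pos_of_mul_pos_right (e ▸ (by linarith) :
        0 < α ^ 2 * (tr v ^ 2 - 4 - (tr (v * (h * v * h⁻¹)) - 2))) h0.le
      linarith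

lemma abs_tr_pow_lt {u : SL2Z} (hu : 2 < |tr u|) (k : ℕ) :
    2 ≤ |tr (u ^ k)| ∧ |tr (u ^ k)| < |tr (u ^ (k + 1))| := by
  induction k with
  | zero => simpa [tr] using hu
  | succ k ih =>
    have e : tr (u ^ (k + 2)) = tr (u ^ (k + 1)) * tr u - tr (u ^ k) := by
      have := tr_mul_inv (u ^ (k + 1)) u
      rw [pow_succ u k, mul_inv_cancel_right, ← pow_succ, ← pow_succ] at this
      linarith
    refine ⟨by linarith, ?_⟩
    have h1 := abs_sub_abs_le_abs_sub (tr (u ^ (k + 1)) * tr u) (tr (u ^ k))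
    rw [← e, abs_mul] at h1
    nlinarith [mul_le_mul_of_nonneg_left (show 3 ≤ |tr u| by omega) (abs_nonneg (tr (u ^ (k + 1))))]

lemma abs_tr_lt_pow {u : SL2Z} (hu : 2 < |tr u|) {k : ℕ} (hk : 2 ≤ k) :
    |tr u| < |tr (u ^ k)| := by
  induction k, hk using Nat.le_induction with
  | base => simpa using (abs_tr_pow_lt hu 1).2
  | succ k _ ih => exact ih.trans (abs_tr_pow_lt hu k).2

lemma exists_primitive_root {g : Gamma} (hg : 2 < |tr (g : SL2Z)|) :
    ∃ p : Gamma × ℕ, 1 ≤ p.2 ∧ NotProperPower p.1 ∧ g = p.1 ^ p.2 := by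
  induction hn : (tr (g : SL2Z)).natAbs using Nat.strong_induction_on generalizing g with
  | _ n ih =>
    by_cases hp : NotProperPower g
    · exact ⟨(g, 1), le_rfl, hp, by simp⟩
    · simp only [NotProperPower, not_not] at hp
      obtain ⟨u, k, hk, rfl⟩ := hp
      have hpow : ((u ^ k : Gamma) : SL2Z) = (u : SL2Z) ^ k := by simp
      have hu := (crosses_of_pow hpow).1 hg
      have hlt := abs_tr_lt_pow hu hk
      rw [← hpow, Int.abs_eq_natAbs, Int.abs_eq_natAbs] at hlt
      obtain ⟨⟨p, m⟩, hm, hp, rfl⟩ := ih (tr (u : SL2Z)).natAbs (by omega) hu rfl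
      exact ⟨(p, m * k), Nat.mul_pos hm (by omega), hp, (pow_mul p m k).symm⟩

lemma card_le_of_pow {g v : Gamma} {k : ℕ} (hk : 1 ≤ k) (hgv : g = v ^ k)
    (hg : 2 < |tr (g : SL2Z)|) {ι : Type*} (F : ι → Gamma)
    (hF : ∀ i, Crosses (g : SL2Z) (F i : SL2Z))
    (hinj : ∀ i j, (∃ a b : ℤ, F j = g ^ a * F i * g ^ b) → i = j) :
    Nat.card ι ≤ k ^ 2 * sTwo v := by
  have hpow : (g : SL2Z) = (v : SL2Z) ^ k := by simp [hgv]
  obtain ⟨c1, c2⟩ := crosses_of_pow hpow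
  have hv := c1 hg
  have := finite_doubleCosets hv
  have hgood : ∀ i, GoodConj v (F i) := fun i => goodConj_iff.mpr ⟨hv, c2 hg _ (hF i)⟩
  set Q := Quot (fun h h' : {h : Gamma // GoodConj v h} =>
      ∃ m k : ℤ, (h' : Gamma) = v ^ m * (h : Gamma) * v ^ k) with hQ
  let cls : ι → Q := fun i => Quot.mk _ ⟨F i, hgood i⟩
  have hrep : ∀ i, ∃ m l : ℤ, F i = v ^ m * ((cls i).out : Gamma) * v ^ l := fun i =>
    doubleCoset_mk_eq (h' := ⟨F i, hgood i⟩) (Quot.out_eq (cls i))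
  choose a b hab using hrep
  have : NeZero k := ⟨by omega⟩
  let f : ι → Q × ZMod k × ZMod k := fun i => (cls i, (a i : ZMod k), (b i : ZMod k))
  have hf : Function.Injective f := by
    intro i j e
    simp only [f, Prod.mk.injEq] at e
    obtain ⟨e1, e2, e3⟩ := e
    rw [ZMod.intCast_eq_intCast_iff_dvd_sub] at e2 e3
    obtain ⟨s, hs⟩ := e2
    obtain ⟨t, ht⟩ := e3
    apply hinj
    refine ⟨s, t, ?_⟩
    have hgz : ∀ s : ℤ, g ^ s = v ^ ((k : ℤ) * s) := fun s => by
      rw [hgv, zpow_mul, zpow_natCast]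
    rw [hab j, hab i, ← e1, hgz, hgz, ← hs, ← ht]
    group
  have h1 := Nat.card_le_card_of_injective f hf
  rw [Nat.card_prod, Nat.card_prod, Nat.card_zmod] at h1
  unfold sTwo
  linarith [h1, show Nat.card Q * (k * k) = k ^ 2 * Nat.card Q by ring]

lemma le_Iγ {g : Gamma} (hg : 2 < |tr (g : SL2Z)|) {ι : Type*} (F : ι → Gamma)
    (hF : ∀ i, Crosses (g : SL2Z) (F i : SL2Z))
    (hinj : ∀ i j, (∃ a b : ℤ, F j = g ^ a * F i * g ^ b) → i = j) {l : ℤ}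
    (hl : 2 * l ≤ Nat.card ι) : l ≤ Iγ g := by
  have hex := exists_primitive_root hg
  unfold Iγ
  rw [dif_pos hex]
  obtain ⟨hk, -, hgv⟩ := hex.choose_spec
  generalize hex.choose.1 = v at *
  generalize hex.choose.2 = k at *
  have hv := (crosses_of_pow (show (g : SL2Z) = (v : SL2Z) ^ k by simp [hgv])).1 hg
  have hcard := card_le_of_pow hk hgv hg F hF hinj
  obtain ⟨s, hs⟩ := two_dvd_sTwo hv
  rw [hs] at hcard ⊢
  rw [Nat.mul_div_cancel_left _ (by norm_num)]
  have hcard' : (Nat.card ι : ℤ) ≤ (k : ℤ) ^ 2 * (2 * s) := by exact_mod_cast hcard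
  have hk' : (1 : ℤ) ≤ k := by exact_mod_cast hk
  nlinarith

/-! ### Equality up to sign -/

/-- Equality in `PSL₂(ℤ)`. -/
def EqPM (g h : SL2Z) : Prop := g = h ∨ g = -h

lemma EqPM.refl (g : SL2Z) : EqPM g g := Or.inl rfl

lemma EqPM.symm {g h : SL2Z} (e : EqPM g h) : EqPM h g := by
  rcases e with rfl | rfl
  · exact Or.inl rfl
  · exact Or.inr (neg_neg h).symm

lemma EqPM.trans {g h k : SL2Z} (e : EqPM g h) (e' : EqPM h k) : EqPM g k := by
  rcases e with rfl | rfl <;> rcases e' with rfl | rfl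
  · exact Or.inl rfl
  · exact Or.inr rfl
  · exact Or.inr rfl
  · exact Or.inl (neg_neg _)

lemma EqPM.mul {g h g' h' : SL2Z} (e : EqPM g h) (e' : EqPM g' h') :
    EqPM (g * g') (h * h') := by
  rcases e with rfl | rfl <;> rcases e' with rfl | rfl
  · exact Or.inl rfl
  · exact Or.inr (mul_neg _ _)
  · exact Or.inr (neg_mul _ _)
  · exact Or.inl (neg_mul_neg _ _)

lemma SL2Z_neg_inv (g : SL2Z) : (-g)⁻¹ = -g⁻¹ := by
  rw [inv_eq_iff_mul_eq_one, neg_mul_neg, mul_inv_cancel]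

lemma EqPM.inv {g h : SL2Z} (e : EqPM g h) : EqPM g⁻¹ h⁻¹ := by
  rcases e with rfl | rfl
  · exact Or.inl rfl
  · exact Or.inr (SL2Z_neg_inv h)

lemma EqPM.zpow {g h : SL2Z} (e : EqPM g h) (m : ℤ) : EqPM (g ^ m) (h ^ m) := by
  induction m with
  | zero => simpa using EqPM.refl 1
  | succ n ih => rw [zpow_add_one, zpow_add_one]; exact ih.mul e
  | pred n ih => rw [zpow_sub_one, zpow_sub_one]; exact ih.mul e.inv

lemma Crosses.congr {g g' h h' : SL2Z} (e : EqPM g g') (e' : EqPM h h') (H : Crosses g h) :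
    Crosses g' h' := by
  rcases e with rfl | rfl <;> rcases e' with rfl | rfl
  · exact H
  · simpa using H.neg_right
  · simpa using H.neg_left
  · simpa using H.neg_left.neg_right

/-! ### The turn sequence of a word -/

/-- The matrices of left and right turns. -/
def turnM : Bool → SL2Z
  | true => ⟨!![1, 1; 0, 1], by norm_num [Matrix.det_fin_two_of]⟩
  | false => ⟨!![1, 0; 1, 1], by norm_num [Matrix.det_fin_two_of]⟩

/-- The rotation of order four. -/
def flipM : SL2Z := ⟨!![0, -1; 1, 0], by norm_num [Matrix.det_fin_two_of]⟩

/-- Whether `b` follows `a` in the cyclic order `x, y, z`. -/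
def follows : Letter → Letter → Bool
  | .x, .y => true
  | .y, .z => true
  | .z, .x => true
  | _, _ => false

/-- The turn made when passing from the edge `a` to the edge `b`; the flag records the parity
of the position. -/
def turnOf (a b : Letter) (p : Bool) : Bool := xor (follows a b) p

/-- Coset representatives attached to a letter and a parity. -/
def letterM : Letter → Bool → SL2Z
  | .x, false => turnM true
  | .y, false => flipM
  | .z, false => turnM false
  | .x, true => turnM true * flipM
  | .y, true => flipM * flipM
  | .z, true => turnM false * flipM

lemma turnM_true_entries : (turnM true).1 0 0 = 1 ∧ (turnM true).1 0 1 = 1 ∧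
    (turnM true).1 1 0 = 0 ∧ (turnM true).1 1 1 = 1 := ⟨rfl, rfl, rfl, rfl⟩

lemma turnM_false_entries : (turnM false).1 0 0 = 1 ∧ (turnM false).1 0 1 = 0 ∧
    (turnM false).1 1 0 = 1 ∧ (turnM false).1 1 1 = 1 := ⟨rfl, rfl, rfl, rfl⟩

lemma flipM_entries : flipM.1 0 0 = 0 ∧ flipM.1 0 1 = -1 ∧
    flipM.1 1 0 = 1 ∧ flipM.1 1 1 = 0 := ⟨rfl, rfl, rfl, rfl⟩

lemma Amat_entries : Amat.1 0 0 = 1 ∧ Amat.1 0 1 = 2 ∧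
    Amat.1 1 0 = 0 ∧ Amat.1 1 1 = 1 := ⟨rfl, rfl, rfl, rfl⟩

lemma Bmat_entries : Bmat.1 0 0 = 1 ∧ Bmat.1 0 1 = 0 ∧
    Bmat.1 1 0 = -2 ∧ Bmat.1 1 1 = 1 := ⟨rfl, rfl, rfl, rfl⟩

lemma flipM_mul_self : flipM * flipM = -1 := by
  apply SL2Z_ext <;> simp [mul_entry, flipM_entries, neg_entry]

lemma letterM_mul_turnM {a b : Letter} (hab : a ≠ b) (p : Bool) :
    EqPM (letterM a p * turnM (turnOf a b p))
      ((if p then 1 else pairM a b) * letterM b (!p)) := by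
  cases a <;> cases b <;> first | exact absurd rfl hab | skip
  all_goals cases p
  all_goals
    simp only [turnOf, follows, letterM, pairM, Cmat, Bool.xor_true, Bool.xor_false, Bool.not_true,
      Bool.not_false, if_true, if_false, Bool.false_eq_true]
    first
      | left
        apply SL2Z_ext <;>
          simp only [mul_entry, inv_entry_00, inv_entry_01, inv_entry_10, inv_entry_11,
          turnM_true_entries, turnM_false_entries, flipM_entries, Amat_entries,
          Bmat_entries, one_entry_00, one_entry_01, one_entry_10, one_entry_11] <;> norm_num; done
      | right
        apply SL2Z_ext <;>
          simp only [mul_entry, inv_entry_00, inv_entry_01, inv_entry_10, inv_entry_11,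
          neg_entry, turnM_true_entries, turnM_false_entries, flipM_entries, Amat_entries,
          Bmat_entries, one_entry_00, one_entry_01, one_entry_10, one_entry_11] <;> norm_num

lemma letterM_mul_flipM (a : Letter) (p : Bool) :
    EqPM (letterM a p * flipM) (letterM a (!p)) := by
  cases a <;> cases p <;> simp only [letterM, Bool.not_true, Bool.not_false, mul_assoc,
    flipM_mul_self, mul_neg, mul_one]
  all_goals first | exact EqPM.refl _ | exact Or.inr rfl | skip
  exact Or.inr (by simp)

/-- The parity of a position. -/
def par (i : ℤ) : Bool := decide (i % 2 = 1)

lemma par_add_one (i : ℤ) : par (i + 1) = !par i := by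
  rw [par, par, ← decide_not]
  congr 1
  rw [eq_iff_iff]; omega

lemma par_add_even {n : ℤ} (hn : 2 ∣ n) (i : ℤ) : par (i + n) = par i := by
  rw [par, par]
  congr 1
  rw [eq_iff_iff]; omega

lemma exists_integer_walk (τ : ℤ → SL2Z) (e : SL2Z) :
    ∃ E : ℤ → SL2Z, E 0 = e ∧ ∀ i, E (i + 1) = E i * τ i := by
  let f : ℕ → SL2Z := fun n => Nat.rec e (fun k x => x * τ k) n
  let b : ℕ → SL2Z := fun n => Nat.rec e (fun k x => x * (τ (-(k + 1 : ℤ)))⁻¹) n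
  refine ⟨fun i => Int.rec (fun n => f n) (fun n => b (n + 1)) i, rfl, ?_⟩
  intro i
  rcases i with n | n
  · rfl
  · cases n with
    | zero =>
      change e = e * (τ (-((0 : ℕ) + 1 : ℤ)))⁻¹ * τ (Int.negSucc 0)
      simp
    | succ n =>
      change b (n + 1) = b (n + 1) * (τ (-((n + 1 : ℕ) + 1 : ℤ)))⁻¹ * τ (Int.negSucc (n + 1))
      rw [Int.negSucc_eq, inv_mul_cancel_right]

lemma walk_unique {τ : ℤ → SL2Z} {E E' : ℤ → SL2Z} (hE : ∀ i, E (i + 1) = E i * τ i)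
    (hE' : ∀ i, E' (i + 1) = E' i * τ i) (h0 : E 0 = E' 0) (i : ℤ) : E i = E' i := by
  induction i with
  | zero => exact h0
  | succ n ih => rw [hE, hE', ih]
  | pred n ih =>
    have h1 := hE (-(n : ℤ) - 1)
    have h2 := hE' (-(n : ℤ) - 1)
    rw [sub_add_cancel] at h1 h2
    rw [h1, h2] at ih
    exact mul_right_cancel ih

/-! ### Matrices with nonnegative entries -/

/-- All entries are nonnegative. -/
def NonnegM (g : SL2Z) : Prop := 0 ≤ g.1 0 0 ∧ 0 ≤ g.1 0 1 ∧ 0 ≤ g.1 1 0 ∧ 0 ≤ g.1 1 1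

lemma NonnegM.one : NonnegM 1 := by simp [NonnegM]

lemma NonnegM.mul {g h : SL2Z} (hg : NonnegM g) (hh : NonnegM h) : NonnegM (g * h) := by
  obtain ⟨g1, g2, g3, g4⟩ := hg
  obtain ⟨h1, h2, h3, h4⟩ := hh
  simp only [NonnegM, mul_entry]
  exact ⟨by positivity, by positivity, by positivity, by positivity⟩

lemma NonnegM.turnM (a : Bool) : NonnegM (turnM a) := by
  cases a
  · simp [NonnegM, turnM_false_entries]
  · simp [NonnegM, turnM_true_entries]

lemma NonnegM.diag {g : SL2Z} (hg : NonnegM g) : 1 ≤ g.1 0 0 ∧ 1 ≤ g.1 1 1 := by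
  obtain ⟨g1, g2, g3, g4⟩ := hg
  have hd := det_entries g
  have h : 0 < g.1 0 0 * g.1 1 1 := by nlinarith
  constructor <;> by_contra! h'
  · have : g.1 0 0 = 0 := by omega
    rw [this] at h; simp at h
  · have : g.1 1 1 = 0 := by omega
    rw [this] at h; simp at h

lemma three_le_tr {N P : SL2Z} (hN : NonnegM N) (hP : NonnegM P) (a : Bool) :
    3 ≤ tr (turnM a * N * turnM (!a) * P) := by
  have d1 := hN.diag
  have d2 := hP.diag
  obtain ⟨g1, g2, g3, g4⟩ := hN
  obtain ⟨h1, h2, h3, h4⟩ := hP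
  cases a <;> simp only [tr, mul_entry, Bool.not_true, Bool.not_false, turnM_true_entries,
    turnM_false_entries] <;>
  nlinarith [mul_nonneg g2 h2, mul_nonneg g2 h3, mul_nonneg g3 h2, mul_nonneg g3 h3,
    mul_nonneg g2 h4, mul_nonneg g3 h4, mul_nonneg g2 h1, mul_nonneg g3 h1, mul_nonneg g1 h2,
    mul_nonneg g1 h3, mul_nonneg g4 h2, mul_nonneg g4 h3,
    mul_nonneg (sub_nonneg.mpr d1.1) (sub_nonneg.mpr d2.1),
    mul_nonneg (sub_nonneg.mpr d1.1) (sub_nonneg.mpr d2.2),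
    mul_nonneg (sub_nonneg.mpr d1.2) (sub_nonneg.mpr d2.1),
    mul_nonneg (sub_nonneg.mpr d1.2) (sub_nonneg.mpr d2.2)]

lemma three_le_tr_mul_inv_aux {N P : SL2Z} (hN : NonnegM N) (hP : NonnegM P) :
    3 ≤ tr (turnM false * N * turnM true * (turnM true * P * turnM false)⁻¹) := by
  have d1 := hN.diag
  have d2 := hP.diag
  have e1 := det_entries N
  have e2 := det_entries P
  obtain ⟨g1, g2, g3, g4⟩ := hN
  obtain ⟨h1, h2, h3, h4⟩ := hP
  have : tr (turnM false * N * turnM true * (turnM true * P * turnM false)⁻¹) =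
      N.1 0 0 * P.1 0 0 + N.1 1 0 * P.1 0 0 + N.1 1 0 * P.1 1 0 + N.1 0 1 * P.1 0 0 +
      N.1 0 1 * P.1 0 1 + N.1 1 1 * (P.1 0 0 + P.1 0 1 + P.1 1 0 + P.1 1 1) := by
    simp only [tr, mul_entry, inv_entry_00, inv_entry_01, inv_entry_10, inv_entry_11,
      turnM_true_entries, turnM_false_entries]
    ring
  rw [this]
  nlinarith [mul_nonneg g3 h1, mul_nonneg g3 h3, mul_nonneg g2 h1, mul_nonneg g2 h2,
    mul_nonneg g4 h2, mul_nonneg g4 h3,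
    mul_nonneg (sub_nonneg.mpr d1.1) (sub_nonneg.mpr d2.1),
    mul_nonneg (sub_nonneg.mpr d1.2) (sub_nonneg.mpr d2.1),
    mul_nonneg (sub_nonneg.mpr d1.2) (sub_nonneg.mpr d2.2)]

lemma three_le_tr_mul_inv {N P : SL2Z} (hN : NonnegM N) (hP : NonnegM P) (a : Bool) :
    3 ≤ tr (turnM a * N * turnM (!a) * (turnM (!a) * P * turnM a)⁻¹) := by
  cases a
  · exact three_le_tr_mul_inv_aux hN hP
  · have := three_le_tr_mul_inv_aux hP hN
    rwa [← tr_inv, mul_inv_rev, inv_inv] at this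

lemma not_eqPM_one {N P : SL2Z} (hN : NonnegM N) (hP : NonnegM P) (a : Bool) :
    ¬ EqPM (N * turnM a * P) 1 := by
  have d1 := hN.diag
  have d2 := hP.diag
  obtain ⟨g1, g2, g3, g4⟩ := hN
  obtain ⟨h1, h2, h3, h4⟩ := hP
  intro e
  have e01 : (N * turnM a * P).1 0 1 = 0 := by
    rcases e with e | e <;> rw [e] <;> simp [neg_entry]
  have e10 : (N * turnM a * P).1 1 0 = 0 := by
    rcases e with e | e <;> rw [e] <;> simp [neg_entry]
  cases a <;> simp only [mul_entry, turnM_true_entries, turnM_false_entries] at e01 e10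
  · nlinarith [mul_nonneg g3 h1, mul_nonneg g4 h3,
      mul_nonneg (sub_nonneg.mpr d1.2) (sub_nonneg.mpr d2.1)]
  · nlinarith [mul_nonneg g1 h2, mul_nonneg g2 h4,
      mul_nonneg (sub_nonneg.mpr d1.1) (sub_nonneg.mpr d2.2)]

lemma not_eqPM_of_last_ne_aux {N P : SL2Z} (hN : NonnegM N) (hP : NonnegM P) :
    ¬ EqPM (N * turnM true) (P * turnM false) := by
  have d1 := hN.diag
  have d2 := hP.diag
  obtain ⟨g1, g2, g3, g4⟩ := hN
  obtain ⟨h1, h2, h3, h4⟩ := hP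
  rintro (e | e)
  · have a0 : (N * turnM true).1 0 0 = (P * turnM false).1 0 0 := by rw [e]
    have a1 : (N * turnM true).1 0 1 = (P * turnM false).1 0 1 := by rw [e]
    simp only [mul_entry, turnM_true_entries, turnM_false_entries] at a0 a1
    linarith
  · have a0 : (N * turnM true).1 0 0 = -(P * turnM false).1 0 0 := by rw [e]; rfl
    simp only [mul_entry, turnM_true_entries, turnM_false_entries] at a0
    linarith

lemma not_eqPM_of_last_ne {N P : SL2Z} (hN : NonnegM N) (hP : NonnegM P) {a b : Bool}
    (hab : a ≠ b) : ¬ EqPM (N * turnM a) (P * turnM b) := by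
  cases a <;> cases b
  · exact absurd rfl hab
  · exact fun e => not_eqPM_of_last_ne_aux hP hN e.symm
  · exact not_eqPM_of_last_ne_aux hN hP
  · exact absurd rfl hab

/-- Comparisons of nonnegative matrices with a quarter turn all fail. -/
lemma not_eqPM_mul_flipM {N P : SL2Z} (hN : NonnegM N) (hP : NonnegM P) :
    ¬ EqPM P (N * flipM) ∧ ¬ EqPM (N * flipM * P) 1 ∧ ¬ EqPM (N * P) flipM ∧
      ¬ EqPM N (flipM * P) := by
  have d1 := hN.diag
  have d2 := hP.diag
  have d3 := (hN.mul hP).diag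
  obtain ⟨g1, g2, g3, g4⟩ := hN
  obtain ⟨h1, h2, h3, h4⟩ := hP
  refine ⟨?_, ?_, ?_, ?_⟩
  · rintro (e | e)
    · have := congrArg (fun g : SL2Z => g.1 0 1) e
      simp only [mul_entry, flipM_entries] at this
      linarith
    · have := congrArg (fun g : SL2Z => g.1 0 0) e
      simp only [mul_entry, flipM_entries, neg_entry] at this
      linarith
  · intro e
    have e' : EqPM (N * flipM) P⁻¹ := by
      have := e.mul (EqPM.refl P⁻¹)
      rwa [mul_inv_cancel_right, one_mul] at this
    rcases e' with e | e
    · have := congrArg (fun g : SL2Z => g.1 1 1) e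
      simp only [mul_entry, flipM_entries, inv_entry_11] at this
      linarith
    · have := congrArg (fun g : SL2Z => g.1 0 0) e
      simp only [mul_entry, flipM_entries, neg_entry, inv_entry_00] at this
      linarith
  · rintro (e | e)
    · rw [e] at d3; simp [flipM_entries] at d3
    · rw [e] at d3; simp [flipM_entries, neg_entry] at d3
  · rintro (e | e)
    · have := congrArg (fun g : SL2Z => g.1 0 0) e
      simp only [mul_entry, flipM_entries] at this
      linarith
    · have := congrArg (fun g : SL2Z => g.1 1 0) e
      simp only [mul_entry, flipM_entries, neg_entry] at this
      linarith

/-- The transpose, written through the quarter turn. -/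
def tp (g : SL2Z) : SL2Z := flipM * g⁻¹ * flipM⁻¹

lemma tp_mul (g h : SL2Z) : tp (g * h) = tp h * tp g := by
  simp only [tp, mul_inv_rev]; group

lemma tp_inv (g : SL2Z) : tp g⁻¹ = (tp g)⁻¹ := by
  simp only [tp]; group

lemma tp_entries (g : SL2Z) : (tp g).1 0 0 = g.1 0 0 ∧ (tp g).1 0 1 = g.1 1 0 ∧
    (tp g).1 1 0 = g.1 0 1 ∧ (tp g).1 1 1 = g.1 1 1 := by
  simp only [tp, mul_entry, inv_entry_00, inv_entry_01, inv_entry_10, inv_entry_11, flipM_entries]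
  refine ⟨?_, ?_, ?_, ?_⟩ <;> ring

lemma tp_turnM (a : Bool) : tp (turnM a) = turnM (!a) := by
  cases a <;> apply SL2Z_ext <;>
    simp [tp_entries, turnM_true_entries, turnM_false_entries]

lemma NonnegM.tp {g : SL2Z} (hg : NonnegM g) : NonnegM (tp g) := by
  obtain ⟨g1, g2, g3, g4⟩ := hg
  simp only [NonnegM, tp_entries]
  exact ⟨g1, g3, g2, g4⟩

/-! ### Walks -/

/-- A bi-infinite product of turn matrices, equivariant under a shift by `n`. -/
structure IsWalk (n : ℤ) (t : ℤ → Bool) (E : ℤ → SL2Z) (g : SL2Z) : Prop where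
  step : ∀ i, E (i + 1) = E i * turnM (t i)
  period : ∀ i, E (i + n) = g * E i
  turn_period : ∀ i, t (i + n) = t i

namespace IsWalk

variable {n : ℤ} {t : ℤ → Bool} {E : ℤ → SL2Z} {g : SL2Z}

lemma nonneg (hW : IsWalk n t E g) {i j : ℤ} (hij : i ≤ j) : NonnegM ((E i)⁻¹ * E j) := by
  induction j, hij using Int.leInduction with
  | base => rw [inv_mul_cancel]; exact NonnegM.one
  | succ j _ ih => rw [hW.step, ← mul_assoc]; exact ih.mul (NonnegM.turnM _)

lemma exists_last (hW : IsWalk n t E g) {i j : ℤ} (hij : i < j) :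
    ∃ N, NonnegM N ∧ (E i)⁻¹ * E j = N * turnM (t (j - 1)) := by
  refine ⟨_, hW.nonneg (show i ≤ j - 1 by omega), ?_⟩
  have := hW.step (j - 1)
  rw [sub_add_cancel] at this
  rw [this, mul_assoc]

lemma exists_first (hW : IsWalk n t E g) {i j : ℤ} (hij : i < j) :
    ∃ N, NonnegM N ∧ (E i)⁻¹ * E j = turnM (t i) * N := by
  refine ⟨_, hW.nonneg (show i + 1 ≤ j by omega), ?_⟩
  rw [hW.step, mul_inv_rev]; group

lemma exists_first_last (hW : IsWalk n t E g) {i j : ℤ} (hij : i + 2 ≤ j) :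
    ∃ N, NonnegM N ∧ (E i)⁻¹ * E j = turnM (t i) * N * turnM (t (j - 1)) := by
  refine ⟨_, hW.nonneg (show i + 1 ≤ j - 1 by omega), ?_⟩
  have := hW.step (j - 1)
  rw [sub_add_cancel] at this
  rw [this, hW.step i, mul_inv_rev]; group

lemma period_zpow (hW : IsWalk n t E g) (i m : ℤ) : E (i + m * n) = g ^ m * E i := by
  induction m with
  | zero => simp
  | succ m ih =>
    rw [show i + ((m : ℤ) + 1) * n = i + m * n + n by ring, hW.period, ih, zpow_add_one,
      (Commute.zpow_self g m).eq, mul_assoc]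
  | pred m ih =>
    have := hW.period (i + (-(m : ℤ) - 1) * n)
    rw [show i + (-(m : ℤ) - 1) * n + n = i + -(m : ℤ) * n by ring, ih] at this
    rw [zpow_sub_one, (Commute.zpow_self g _).inv_right.eq, mul_assoc, this, inv_mul_cancel_left]

lemma not_eqPM_of_lt (hW : IsWalk n t E g) {i j : ℤ} (hij : i < j) :
    ¬ EqPM ((E i)⁻¹ * E j) 1 := by
  obtain ⟨N, hN, e⟩ := hW.exists_last hij
  rw [e, ← mul_one (N * _)]
  exact not_eqPM_one hN NonnegM.one _

lemma eq_of_eqPM_one (hW : IsWalk n t E g) {i j : ℤ} (e : EqPM ((E i)⁻¹ * E j) 1) : i = j := by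
  rcases lt_trichotomy i j with h | h | h
  · exact absurd e (hW.not_eqPM_of_lt h)
  · exact h
  · refine absurd ?_ (hW.not_eqPM_of_lt h)
    have := e.inv
    rwa [inv_one, mul_inv_rev, inv_inv] at this

lemma same_injective_of_le (hW : IsWalk n t E g) {i i' j j' : ℤ} (hi : i ≤ i')
    (e : EqPM ((E i)⁻¹ * E i') ((E j)⁻¹ * E j')) (ht' : t (i' - 1) ≠ t (j' - 1)) :
    i = i' ∧ j = j' := by
  rcases hi.eq_or_lt with rfl | hlt
  · rw [inv_mul_cancel] at e
    exact ⟨rfl, hW.eq_of_eqPM_one e.symm⟩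
  · exfalso
    obtain ⟨N, hN, eN⟩ := hW.exists_last hlt
    rcases lt_or_ge j j' with h | h
    · obtain ⟨P, hP, eP⟩ := hW.exists_last h
      rw [eN, eP] at e
      exact not_eqPM_of_last_ne hN hP ht' e
    · have := e.mul (EqPM.refl ((E j')⁻¹ * E j))
      rw [eN, show (E j)⁻¹ * E j' * ((E j')⁻¹ * E j) = 1 by group] at this
      exact not_eqPM_one hN (hW.nonneg h) _ this

lemma same_injective (hW : IsWalk n t E g) {i i' j j' : ℤ}
    (e : EqPM ((E i)⁻¹ * E i') ((E j)⁻¹ * E j')) (ht : t (i - 1) ≠ t (j - 1))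
    (ht' : t (i' - 1) ≠ t (j' - 1)) : i = i' ∧ j = j' := by
  rcases le_total i i' with h | h
  · exact hW.same_injective_of_le h e ht'
  · have e' := e.inv
    rw [mul_inv_rev, mul_inv_rev, inv_inv, inv_inv] at e'
    obtain ⟨h1, h2⟩ := hW.same_injective_of_le h e' ht
    exact ⟨h1.symm, h2.symm⟩

lemma anti_injective_of_le (hW : IsWalk n t E g) {i i' j j' : ℤ} (hi : i ≤ i')
    (e : EqPM ((E i)⁻¹ * E i') (tp ((E j)⁻¹ * E j'))⁻¹) (ht' : t (i' - 1) = t j') :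
    i = i' ∧ j = j' := by
  rcases hi.eq_or_lt with rfl | hlt
  · refine ⟨rfl, hW.eq_of_eqPM_one ?_⟩
    have h1 := ((EqPM.refl flipM⁻¹).mul e.symm).mul (EqPM.refl flipM)
    rw [inv_mul_cancel, mul_one, inv_mul_cancel, ← tp_inv] at h1
    simp only [tp, inv_inv, mul_assoc] at h1
    simpa using h1
  · exfalso
    obtain ⟨N, hN, eN⟩ := hW.exists_last hlt
    rcases lt_or_ge j' j with h | h
    · obtain ⟨P, hP, eP⟩ := hW.exists_first h
      rw [eN, ← tp_inv, mul_inv_rev, inv_inv, eP, tp_mul, tp_turnM] at e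
      exact not_eqPM_of_last_ne hN hP.tp (by rw [ht']; simp) e
    · have := e.mul (EqPM.refl (tp ((E j)⁻¹ * E j')))
      rw [eN, inv_mul_cancel] at this
      exact not_eqPM_one hN (hW.nonneg h).tp _ this

lemma anti_injective (hW : IsWalk n t E g) {i i' j j' : ℤ}
    (e : EqPM ((E i)⁻¹ * E i') (tp ((E j)⁻¹ * E j'))⁻¹) (ht : t (i - 1) = t j)
    (ht' : t (i' - 1) = t j') : i = i' ∧ j = j' := by
  rcases le_total i i' with h | h
  · exact hW.anti_injective_of_le h e ht'
  · have e' := e.inv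
    rw [← tp_inv, ← tp_inv, mul_inv_rev, inv_inv, inv_inv] at e'
    have e'' : EqPM ((E i')⁻¹ * E i) (tp ((E j')⁻¹ * E j))⁻¹ := by
      rwa [← tp_inv, mul_inv_rev, inv_inv]
    obtain ⟨h1, h2⟩ := hW.anti_injective_of_le h e'' ht
    exact ⟨h1.symm, h2.symm⟩

lemma not_eqPM_flip (hW : IsWalk n t E g) (i i' j j' : ℤ) :
    ¬ EqPM ((E j)⁻¹ * E j') ((E i)⁻¹ * E i' * flipM) := by
  intro e
  rcases le_total i i' with hi | hi <;> rcases le_total j j' with hj | hj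
  · exact (not_eqPM_mul_flipM (hW.nonneg hi) (hW.nonneg hj)).1 e
  · refine (not_eqPM_mul_flipM (hW.nonneg hi) (hW.nonneg hj)).2.1 ?_
    have := e.mul (EqPM.refl ((E j')⁻¹ * E j))
    rw [show (E j)⁻¹ * E j' * ((E j')⁻¹ * E j) = 1 by group] at this
    exact this.symm
  · refine (not_eqPM_mul_flipM (hW.nonneg hi) (hW.nonneg hj)).2.2.1 ?_
    have := (EqPM.refl ((E i')⁻¹ * E i)).mul e
    rwa [show (E i')⁻¹ * E i * ((E i)⁻¹ * E i' * flipM) = flipM by group] at this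
  · refine (not_eqPM_mul_flipM (hW.nonneg hi) (hW.nonneg hj)).2.2.2 ?_
    have := ((EqPM.refl ((E i')⁻¹ * E i)).mul e).mul (EqPM.refl ((E j')⁻¹ * E j))
    rwa [show (E i')⁻¹ * E i * ((E j)⁻¹ * E j') * ((E j')⁻¹ * E j) = (E i')⁻¹ * E i by group,
      show (E i')⁻¹ * E i * ((E i)⁻¹ * E i' * flipM) * ((E j')⁻¹ * E j) =
        flipM * ((E j')⁻¹ * E j) by group] at this

lemma monodromy (hW : IsWalk n t E g) (i : ℤ) : (E i)⁻¹ * E (i + n) = (E i)⁻¹ * g * E i := by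
  rw [hW.period, mul_assoc]

/-- A pair of positions whose strands run in the same direction, fellow-travel for `k` steps and
end up on the opposite sides. -/
lemma crosses_same (hW : IsWalk n t E g) {i j : ℤ} {k : ℕ} (hk : (k : ℤ) + 2 ≤ n)
    (h₁ : t (i - 1) ≠ t (j - 1)) (h₂ : ∀ m : ℕ, m < k → t (i + m) = t (j + m))
    (h₃ : t (i + k) ≠ t (j + k)) (h₄ : t (i + k) ≠ t (i - 1)) :
    Crosses g (E i * (E j)⁻¹) := by
  have hT : ∀ m : ℕ, m ≤ k → (E i)⁻¹ * E (i + m) = (E j)⁻¹ * E (j + m) := by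
    intro m hm
    induction m with
    | zero => simp
    | succ m ih =>
      push_cast
      rw [← add_assoc, ← add_assoc, hW.step, hW.step, ← mul_assoc, ← mul_assoc, ih (by omega),
        h₂ m (by omega)]
  have hTk := hT k le_rfl
  obtain ⟨N, hN, eN⟩ := hW.exists_first_last (show i + k + 2 ≤ i + n by omega)
  obtain ⟨P, hP, eP⟩ := hW.exists_first_last (show j + k + 2 ≤ j + n by omega)
  have hlast : ∀ i : ℤ, t (i + n - 1) = t (i - 1) := fun i => by
    rw [show i + n - 1 = i - 1 + n by ring, hW.turn_period]
  rw [hlast] at eN eP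
  set a := t (i + k) with ha
  have ha1 : t (i - 1) = !a := Bool.eq_not_of_ne h₄.symm
  have ha2 : t (j + k) = !a := Bool.eq_not_of_ne h₃.symm
  have ha3 : t (j - 1) = a := by
    rw [ha1] at h₁
    exact Bool.not_eq_not.mp h₁.symm
  rw [ha1] at eN
  rw [ha2, ha3] at eP
  set T := (E i)⁻¹ * E (i + k) with hTdef
  have hTn : NonnegM T := hW.nonneg (by omega)
  set X := (E (i + k))⁻¹ * E (i + n) with hX
  set Y := (E (j + k))⁻¹ * E (j + n) with hY
  have Mi : (E i)⁻¹ * g * E i = T * X := by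
    rw [← hW.monodromy, hTdef, hX]; group
  have Mj : (E j)⁻¹ * g * E j = T * Y := by
    rw [← hW.monodromy, hTk, hY]; group
  apply crosses_of_tr_gt
  · rw [show g * (E i * (E j)⁻¹ * g * (E i * (E j)⁻¹)⁻¹) =
      E i * (((E i)⁻¹ * g * E i) * ((E j)⁻¹ * g * E j)) * (E i)⁻¹ by group, tr_conj, Mi, Mj,
      show T * X * (T * Y) = T * (X * (T * Y * T)) * T⁻¹ by group, tr_conj, eN]
    have hYn : NonnegM Y := hW.nonneg (by omega)
    have := three_le_tr hN ((hTn.mul hYn).mul hTn) a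
    linarith
  · rw [show g * (E i * (E j)⁻¹ * g * (E i * (E j)⁻¹)⁻¹)⁻¹ =
      E i * (((E i)⁻¹ * g * E i) * ((E j)⁻¹ * g * E j)⁻¹) * (E i)⁻¹ by group, tr_conj, Mi, Mj,
      show T * X * (T * Y)⁻¹ = T * (X * Y⁻¹) * T⁻¹ by group, tr_conj, eN, eP]
    have := three_le_tr_mul_inv hN hP a
    linarith

/-- A pair of turning positions whose strands run in opposite directions. -/
lemma crosses_anti (hW : IsWalk n t E g) (hn : 2 ≤ n) {i j : ℤ} (h₁ : t (i - 1) ≠ t i)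
    (h₂ : t (j - 1) ≠ t j) (h₃ : t i ≠ t j) : Crosses g (E i * flipM * (E j)⁻¹) := by
  obtain ⟨N, hN, eN⟩ := hW.exists_first_last (show i + 2 ≤ i + n by omega)
  obtain ⟨P, hP, eP⟩ := hW.exists_first_last (show j + 2 ≤ j + n by omega)
  have hlast : ∀ i : ℤ, t (i + n - 1) = t (i - 1) := fun i => by
    rw [show i + n - 1 = i - 1 + n by ring, hW.turn_period]
  rw [hlast] at eN eP
  set a := t i with ha
  have ha1 : t (i - 1) = !a := Bool.eq_not_of_ne h₁
  have ha2 : t j = !a := Bool.eq_not_of_ne h₃.symm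
  have ha3 : t (j - 1) = a := by
    rw [ha2] at h₂
    exact (Bool.eq_not_of_ne h₂).trans (Bool.not_not a)
  rw [ha1, hW.monodromy] at eN
  rw [ha2, ha3, hW.monodromy] at eP
  have etp : flipM * ((E j)⁻¹ * g * E j) * flipM⁻¹ = (turnM (!a) * tp P * turnM a)⁻¹ := by
    have : flipM * ((E j)⁻¹ * g * E j) * flipM⁻¹ = (tp ((E j)⁻¹ * g * E j))⁻¹ := by
      simp only [tp]; group
    rw [this, eP, tp_mul, tp_mul, tp_turnM, tp_turnM, Bool.not_not, mul_assoc]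
  apply crosses_of_tr_gt
  · rw [show g * (E i * flipM * (E j)⁻¹ * g * (E i * flipM * (E j)⁻¹)⁻¹) =
      E i * (((E i)⁻¹ * g * E i) * (flipM * ((E j)⁻¹ * g * E j) * flipM⁻¹)) * (E i)⁻¹ by group,
      tr_conj, etp, eN]
    have := three_le_tr_mul_inv hN hP.tp a
    linarith
  · rw [show g * (E i * flipM * (E j)⁻¹ * g * (E i * flipM * (E j)⁻¹)⁻¹)⁻¹ =
      E i * (((E i)⁻¹ * g * E i) * (flipM * ((E j)⁻¹ * g * E j) * flipM⁻¹)⁻¹) * (E i)⁻¹ by group,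
      tr_conj, etp, eN, inv_inv]
    have := three_le_tr hN (((NonnegM.turnM (!a)).mul hP.tp).mul (NonnegM.turnM a)) a
    linarith

lemma tr_gt_two (hW : IsWalk n t E g) (hn : 2 ≤ n) {i : ℤ} (h₁ : t (i - 1) ≠ t i) :
    2 < tr g := by
  obtain ⟨N, hN, eN⟩ := hW.exists_first_last (show i + 2 ≤ i + n by omega)
  rw [hW.monodromy, show i + n - 1 = i - 1 + n by ring, hW.turn_period,
    Bool.eq_not_of_ne h₁] at eN
  have h1 := three_le_tr hN NonnegM.one (t i)
  rw [mul_one, ← eN] at h1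
  have h2 := tr_conj g (E i)⁻¹
  rw [inv_inv] at h2
  linarith

end IsWalk

/-! ### The walk of a word -/

/-- The turn sequence of a bi-infinite word. -/
def turnSeq (W : ℤ → Letter) (i : ℤ) : Bool := turnOf (W i) (W (i + 1)) (par i)

/-- The bi-infinite periodic word obtained by repeating `w`. -/
def unroll (w : List Letter) (i : ℤ) : Letter := cget w (i % w.length).toNat

lemma unroll_period (w : List Letter) (i : ℤ) : unroll w (i + w.length) = unroll w i := by
  rw [unroll, unroll, Int.add_emod_right]

lemma unroll_natCast (w : List Letter) {k : ℕ} (hk : k < w.length) :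
    unroll w k = w[k] := by
  rw [unroll, ← Int.natCast_emod, Int.toNat_natCast, cget, Nat.mod_mod, Nat.mod_eq_of_lt hk,
    List.getD_eq_getElem _ _ hk]

lemma unroll_ne {w : List Letter} (hw : CyclRed w) (i : ℤ) : unroll w i ≠ unroll w (i + 1) := by
  have hpos : 0 < (w.length : ℤ) := by
    have := List.length_pos_of_ne_nil hw.1
    omega
  have h0 := Int.emod_nonneg i hpos.ne'
  have h1 := Int.emod_lt_of_pos i hpos
  have h := hw.2 (i % w.length).toNat (by omega)
  have e : unroll w (i + 1) = cget w ((i % w.length).toNat + 1) := by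
    simp only [unroll, cget]
    congr 1
    zify
    rw [Int.toNat_of_nonneg (Int.emod_nonneg _ hpos.ne'), Int.toNat_of_nonneg h0]
    simp
  rwa [e]

lemma exists_unroll_eq {w : List Letter} {a : Letter} (ha : a ∈ w) : ∃ i, unroll w i = a := by
  obtain ⟨k, hk, rfl⟩ := List.getElem_of_mem ha
  exact ⟨k, unroll_natCast w hk⟩

lemma phiM_append_pair (a b : Letter) :
    ∀ l : List Letter, 2 ∣ l.length → phiM (l ++ [a, b]) = phiM l * pairM a b
  | [], _ => by simp [phiM]
  | [_], h => by simp at h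
  | _ :: _ :: l, h => by
    have : 2 ∣ l.length := by simp only [List.length_cons] at h; omega
    simp only [List.cons_append, phiM, phiM_append_pair a b l this, mul_assoc]

lemma par_of_even {i : ℤ} (h : 2 ∣ i) : par i = false := by
  rw [par, decide_eq_false_iff_not]; omega

section

variable {W : ℤ → Letter} {E : ℤ → SL2Z}

lemma walk_step_coset (hne : ∀ i, W i ≠ W (i + 1)) (i : ℤ) :
    ∃ δ ∈ Gamma, EqPM (letterM (W i) (par i) * turnM (turnSeq W i))
      (δ * letterM (W (i + 1)) (par (i + 1))) := by
  refine ⟨_, ?_, par_add_one i ▸ letterM_mul_turnM (hne i) (par i)⟩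
  split_ifs
  · exact one_mem _
  · exact pairM_mem _ _

lemma walk_coset (hne : ∀ i, W i ≠ W (i + 1))
    (hE : ∀ i, E (i + 1) = E i * turnM (turnSeq W i)) (h0 : E 0 = letterM (W 0) false) (i : ℤ) :
    ∃ γ ∈ Gamma, EqPM (E i) (γ * letterM (W i) (par i)) := by
  induction i with
  | zero => exact ⟨1, one_mem _, by rw [h0, one_mul]; exact EqPM.refl _⟩
  | succ i ih =>
    obtain ⟨γ, hγ, e⟩ := ih
    obtain ⟨δ, hδ, e'⟩ := walk_step_coset hne i
    refine ⟨γ * δ, mul_mem hγ hδ, ?_⟩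
    rw [hE, mul_assoc]
    refine (e.mul (EqPM.refl _)).trans ?_
    rw [mul_assoc]
    exact (EqPM.refl _).mul e'
  | pred i ih =>
    obtain ⟨γ, hγ, e⟩ := ih
    obtain ⟨δ, hδ, e'⟩ := walk_step_coset hne (-(i : ℤ) - 1)
    have hs := hE (-(i : ℤ) - 1)
    rw [sub_add_cancel] at hs e'
    refine ⟨γ * δ⁻¹, mul_mem hγ (inv_mem hδ), ?_⟩
    rw [← mul_inv_cancel_right (E (-(i : ℤ) - 1)) (turnM (turnSeq W (-(i : ℤ) - 1))), ← hs]
    have h2 := (((EqPM.refl δ⁻¹).mul e').mul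
      (EqPM.refl (turnM (turnSeq W (-(i : ℤ) - 1)))⁻¹)).symm
    rw [inv_mul_cancel_left, mul_assoc, mul_assoc, mul_inv_cancel, mul_one] at h2
    have h3 := (EqPM.refl γ).mul h2
    rw [← mul_assoc, ← mul_assoc] at h3
    exact (e.mul (EqPM.refl _)).trans h3

end

lemma walk_prefix {w : List Letter} (hw : CyclRed w) {E : ℤ → SL2Z}
    (hE : ∀ i, E (i + 1) = E i * turnM (turnSeq (unroll w) i))
    (h0 : E 0 = letterM (unroll w 0) false) (k : ℕ) (hk : 2 * k ≤ w.length) :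
    EqPM (E (2 * k : ℕ)) (phiM (w.take (2 * k)) * letterM (unroll w (2 * k : ℕ)) false) := by
  induction k with
  | zero => simpa [phiM, h0] using EqPM.refl (letterM (unroll w 0) false)
  | succ k ih =>
    have ih := ih (by omega)
    have e1 := letterM_mul_turnM (unroll_ne hw (2 * k : ℕ)) false
    have e2 := letterM_mul_turnM (unroll_ne hw ((2 * k : ℕ) + 1)) true
    have p1 : par (2 * k : ℕ) = false := par_of_even (by push_cast; omega)
    have p2 : par ((2 * k : ℕ) + 1) = true := by rw [par_add_one, p1]; rfl
    have htake : w.take (2 * (k + 1)) =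
        w.take (2 * k) ++ [unroll w (2 * k : ℕ), unroll w ((2 * k : ℕ) + 1)] := by
      have hc : ((2 * k : ℕ) : ℤ) + 1 = (2 * k + 1 : ℕ) := by push_cast; rfl
      rw [hc, unroll_natCast w (show 2 * k < w.length by omega),
        unroll_natCast w (show 2 * k + 1 < w.length by omega),
        show 2 * (k + 1) = 2 * k + 1 + 1 by ring, List.take_succ_eq_append_getElem (by omega),
        List.take_succ_eq_append_getElem (by omega), List.append_assoc]
      rfl
    have hc : ((2 * (k + 1) : ℕ) : ℤ) = (2 * k : ℕ) + 1 + 1 := by push_cast; ring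
    rw [hc, hE, hE, htake, phiM_append_pair _ _ _ (by simp; omega), turnSeq, turnSeq, p1, p2]
    simp only [Bool.false_eq_true, if_false, if_true, Bool.not_false, Bool.not_true,
      one_mul] at e1 e2
    have h1 := (ih.mul (EqPM.refl (turnM (turnOf (unroll w (2 * k : ℕ))
      (unroll w ((2 * k : ℕ) + 1)) false)))).mul (EqPM.refl (turnM (turnOf
      (unroll w ((2 * k : ℕ) + 1)) (unroll w ((2 * k : ℕ) + 1 + 1)) true)))
    refine h1.trans ?_
    have h3 := e1.mul (EqPM.refl (turnM (turnOf (unroll w ((2 * k : ℕ) + 1))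
      (unroll w ((2 * k : ℕ) + 1 + 1)) true)))
    rw [mul_assoc (pairM _ _)] at h3
    have h2 := (EqPM.refl (phiM (w.take (2 * k)))).mul (h3.trans ((EqPM.refl _).mul e2))
    simpa only [mul_assoc] using h2

/-- The walk of a cyclically reduced word of even length. -/
lemma exists_isWalk {w : List Letter} (hw : CyclRed w) (heven : 2 ∣ w.length) :
    ∃ (E : ℤ → SL2Z) (g : SL2Z), IsWalk w.length (turnSeq (unroll w)) E g ∧ EqPM g (phiM w) ∧
      ∀ i, ∃ γ ∈ Gamma, EqPM (E i) (γ * letterM (unroll w i) (par i)) := by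
  obtain ⟨E, h0, hE⟩ := exists_integer_walk (fun i => turnM (turnSeq (unroll w) i))
    (letterM (unroll w 0) false)
  have hper : ∀ i, turnSeq (unroll w) (i + w.length) = turnSeq (unroll w) i := fun i => by
    rw [turnSeq, turnSeq, unroll_period, par_add_even (by omega), add_right_comm, unroll_period]
  refine ⟨E, E w.length * (E 0)⁻¹, ⟨hE, fun i => ?_, hper⟩, ?_, walk_coset (unroll_ne hw) hE h0⟩
  · refine walk_unique (τ := fun i => turnM (turnSeq (unroll w) i))
      (E := fun i => E (i + w.length)) (E' := fun i => E w.length * (E 0)⁻¹ * E i)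
      (fun i => ?_) (fun i => ?_) ?_ i
    · simp only [add_right_comm i, hE, hper]
    · simp only [hE, mul_assoc]
    · simp
  · obtain ⟨k, hk⟩ := heven
    have := walk_prefix hw hE h0 k hk.ge
    rw [← hk, List.take_length] at this
    have hz : unroll w w.length = unroll w 0 := by
      rw [← unroll_period w 0, zero_add]
    rw [hz, ← h0] at this
    have := this.mul (EqPM.refl (E 0)⁻¹)
    rwa [mul_inv_cancel_right] at this

/-! ### Pairs of crossing strands -/

/-- The strands at positions `i` and `j` run in the same direction and cross. -/
def SamePair (n : ℤ) (t : ℤ → Bool) (i j : ℤ) : Prop :=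
  ∃ k : ℕ, (k : ℤ) + 2 ≤ n ∧ t (i - 1) ≠ t (j - 1) ∧ (∀ m : ℕ, m < k → t (i + m) = t (j + m)) ∧
    t (i + k) ≠ t (j + k) ∧ t (i + k) ≠ t (i - 1)

/-- The strands at positions `i` and `j` run in opposite directions and cross. -/
def AntiPair (t : ℤ → Bool) (i j : ℤ) : Prop :=
  t (i - 1) ≠ t i ∧ t (j - 1) ≠ t j ∧ t i ≠ t j

/-- The positions `p.1` and `p.2` of a periodic word carry the same letter and crossing strands. -/
def CrossPair (n : ℤ) (W : ℤ → Letter) (p : ℤ × ℤ) : Prop :=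
  W p.1 = W p.2 ∧ (par p.1 = par p.2 ∧ SamePair n (turnSeq W) p.1 p.2 ∨
    par p.1 ≠ par p.2 ∧ AntiPair (turnSeq W) p.1 p.2)

/-- The matrix comparing the positions `p.1` and `p.2`. -/
noncomputable def comparison (E : ℤ → SL2Z) (p : ℤ × ℤ) : SL2Z :=
  if par p.1 = par p.2 then E p.1 * (E p.2)⁻¹ else E p.1 * flipM * (E p.2)⁻¹

lemma comparison_mem {W : ℤ → Letter} {E : ℤ → SL2Z}
    (hE : ∀ i, ∃ γ ∈ Gamma, EqPM (E i) (γ * letterM (W i) (par i))) {p : ℤ × ℤ}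
    (hp : W p.1 = W p.2) : ∃ γ ∈ Gamma, EqPM (comparison E p) γ := by
  obtain ⟨γ, hγ, e⟩ := hE p.1
  obtain ⟨δ, hδ, e'⟩ := hE p.2
  refine ⟨γ * δ⁻¹, mul_mem hγ (inv_mem hδ), ?_⟩
  rw [comparison]
  split_ifs with h
  · have := e.mul e'.inv
    rwa [hp, h, mul_inv_rev, mul_assoc γ, mul_inv_cancel_left] at this
  · have hpar : par p.2 = !par p.1 := Bool.eq_not_of_ne (Ne.symm h)
    have h1 := (EqPM.refl γ).mul (letterM_mul_flipM (W p.1) (par p.1))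
    rw [← mul_assoc] at h1
    replace h1 := (e.mul (EqPM.refl flipM)).trans h1
    have := h1.mul e'.inv
    rwa [hp, hpar, mul_inv_rev, mul_assoc γ, mul_inv_cancel_left] at this

namespace IsWalk

variable {n : ℤ} {W : ℤ → Letter} {E : ℤ → SL2Z} {g : SL2Z}

lemma crosses_comparison (hE : IsWalk n (turnSeq W) E g) (hn : 2 ≤ n) {p : ℤ × ℤ}
    (hp : CrossPair n W p) : Crosses g (comparison E p) := by
  rw [comparison]
  rcases hp.2 with ⟨h, k, hk, h1, h2, h3, h4⟩ | ⟨h, h1, h2, h3⟩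
  · rw [if_pos h]
    exact hE.crosses_same hk h1 h2 h3 h4
  · rw [if_neg h]
    exact hE.crosses_anti hn h1 h2 h3

lemma turn_period_zpow {t : ℤ → Bool} (hE : IsWalk n t E g) (i m : ℤ) : t (i + m * n) = t i := by
  induction m with
  | zero => simp
  | succ m ih => rw [← ih, ← hE.turn_period (i + m * n)]; congr 1; ring
  | pred m ih => rw [← ih, ← hE.turn_period (i + (-(m : ℤ) - 1) * n)]; congr 1; ring

lemma comparison_injective (hE : IsWalk n (turnSeq W) E g) {p q : ℤ × ℤ}
    (hp : CrossPair n W p) (hq : CrossPair n W q) {a b : ℤ}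
    (e : EqPM (comparison E q) (g ^ a * comparison E p * g ^ b)) :
    n ∣ q.1 - p.1 ∧ n ∣ q.2 - p.2 := by
  obtain ⟨i, j⟩ := p
  obtain ⟨i', j'⟩ := q
  have hi : g ^ a = E (i + a * n) * (E i)⁻¹ := by rw [hE.period_zpow]; group
  have hj : g ^ b = E j * (E (j + -b * n))⁻¹ := by rw [hE.period_zpow]; group
  suffices i + a * n = i' ∧ j + -b * n = j' by
    obtain ⟨rfl, rfl⟩ := this
    exact ⟨⟨a, by ring⟩, ⟨-b, by ring⟩⟩
  have t1 : ∀ c, turnSeq W (i + a * n - c) = turnSeq W (i - c) := fun c => by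
    rw [show i + a * n - c = i - c + a * n by ring, hE.turn_period_zpow]
  have t2 : ∀ c, turnSeq W (j + -b * n - c) = turnSeq W (j - c) := fun c => by
    rw [show j + -b * n - c = j - c + -b * n by ring, hE.turn_period_zpow]
  have e' := (EqPM.refl (E (i + a * n))⁻¹).mul (e.mul (EqPM.refl (E j')))
  rw [hi, hj, comparison, comparison] at e'
  rcases hp.2 with ⟨h, k, hk, h1, -⟩ | ⟨h, h1, h2, h3⟩ <;>
    rcases hq.2 with ⟨h', k', hk', h1', -⟩ | ⟨h', h1', h2', h3'⟩
  · rw [if_pos h, if_pos h'] at e'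
    refine hE.same_injective ?_ (by rw [t1, t2]; exact h1) h1'
    convert e' using 1 <;> generalize E (i + a * n) = x <;>
      generalize E (j + -b * n) = y <;> group
  · rw [if_pos h, if_neg h'] at e'
    refine absurd ?_ (hE.not_eqPM_flip (i + a * n) i' (j + -b * n) j')
    convert e'.symm using 1 <;> generalize E (i + a * n) = x <;>
      generalize E (j + -b * n) = y <;> group
  · rw [if_neg h, if_pos h'] at e'
    refine absurd ?_ (hE.not_eqPM_flip i' (i + a * n) j' (j + -b * n))
    convert (e'.inv.mul (EqPM.refl flipM)).symm using 1 <;>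
      generalize E (i + a * n) = x <;>
      generalize E (j + -b * n) = y <;> group
  · rw [if_neg h, if_neg h'] at e'
    refine hE.anti_injective ?_ ?_ ?_
    · rw [tp]
      convert e'.mul (EqPM.refl flipM⁻¹) using 1 <;> generalize E (i + a * n) = x <;>
      generalize E (j + -b * n) = y <;> group
    · have ht := t2 0
      rw [sub_zero, sub_zero] at ht
      rw [t1, ht]
      exact (Bool.eq_not_of_ne h1).trans (Bool.eq_not_of_ne h3.symm).symm
    · exact (Bool.eq_not_of_ne h1').trans (Bool.eq_not_of_ne h3'.symm).symm

end IsWalk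

/-- Pairwise inequivalent crossing pairs bound the self-intersection number from below. -/
lemma le_Iw {w : List Letter} (hw : CyclRed w) (heven : 2 ∣ w.length) (hn : 2 ≤ w.length)
    (hyp : Hyperbolic (phiM w)) {ι : Type} (f : ι → ℤ × ℤ)
    (hf : ∀ x, CrossPair w.length (unroll w) (f x))
    (hinj : ∀ x y, (w.length : ℤ) ∣ (f y).1 - (f x).1 → (w.length : ℤ) ∣ (f y).2 - (f x).2 → x = y)
    {l : ℤ} (hl : 2 * l ≤ Nat.card ι) : l ≤ Iw w := by
  obtain ⟨E, g, hE, eg, hcoset⟩ := exists_isWalk hw heven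
  choose F hF eF using fun x => comparison_mem hcoset (hf x).1
  refine le_Iγ (g := ⟨phiM w, phiM_mem w⟩) ((hyperbolic_iff_tr _).mp hyp)
    (fun x => ⟨F x, hF x⟩) (fun x => ?_) (fun x y h => ?_) hl
  · exact Crosses.congr eg (eF x) (hE.crosses_comparison (by exact_mod_cast hn) (hf x))
  · obtain ⟨a, b, h⟩ := h
    have h' : F y = phiM w ^ a * F x * phiM w ^ b := by
      simpa using congrArg (Subtype.val) h
    have e : EqPM (comparison E (f y)) (g ^ a * comparison E (f x) * g ^ b) := by
      refine (eF y).trans ?_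
      rw [h']
      exact (((eg.symm.zpow a).mul (eF x).symm).mul (eg.symm.zpow b))
    obtain ⟨h1, h2⟩ := hE.comparison_injective (hf x) (hf y) e
    exact hinj x y h1 h2

lemma hyperbolic_phiM {w : List Letter} (hw : CyclRed w) (heven : 2 ∣ w.length)
    (hn : 2 ≤ w.length) {i : ℤ} (hi : turnSeq (unroll w) (i - 1) ≠ turnSeq (unroll w) i) :
    Hyperbolic (phiM w) := by
  obtain ⟨E, g, hE, eg, -⟩ := exists_isWalk hw heven
  have h := hE.tr_gt_two (by exact_mod_cast hn) hi
  rw [hyperbolic_iff_tr]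
  rcases eg.symm with e | e
  · rw [e]
    exact h.trans_le (le_abs_self _)
  · rw [e, tr_neg, abs_neg]
    exact h.trans_le (le_abs_self _)

/-! ### Starts of runs of equal turns -/

/-- The turn changes at position `i`. -/
def IsStart (W : ℤ → Letter) (i : ℤ) : Prop := turnSeq W (i - 1) ≠ turnSeq W i

/-- The distance from `i` back to the last start. -/
noncomputable def lag (W : ℤ → Letter) (i : ℤ) : ℕ := sInf {k : ℕ | IsStart W (i - k)}

lemma turnOf_eq_turnOf_not {a b c : Letter} (hab : a ≠ b) (hbc : b ≠ c) (p : Bool) :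
    turnOf a b p = turnOf b c (!p) ↔ c = a := by
  cases a <;> cases b <;> cases c <;> cases p <;> simp_all [turnOf, follows]

lemma SamePair.of_run {n : ℤ} {t : ℤ → Bool} (hp : ∀ i, t (i + n) = t i) {s : ℤ} {r : ℕ}
    (hn : 2 ≤ n) (hr : 2 ≤ r) (hs : t (s - 1) ≠ t s) (hc : ∀ m : ℕ, m ≤ r → t (s + m) = t s) :
    SamePair n t s (s + r) ∧ SamePair n t (s + r) s := by
  have hlast : t (s + (n - 1).toNat) ≠ t s := by
    rw [Int.toNat_of_nonneg (by omega), show s + (n - 1) = s - 1 + n by ring, hp]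
    exact hs
  have hex : ∃ m : ℕ, t (s + m) ≠ t s := ⟨_, hlast⟩
  set M := Nat.find hex with hM
  have h1 : t (s + M) ≠ t s := Nat.find_spec hex
  have h2 : ∀ m < M, t (s + m) = t s := fun m hm => not_not.mp (Nat.find_min hex hm)
  have h3 : M ≤ (n - 1).toNat := Nat.find_min' hex hlast
  have h4 : r < M := by
    by_contra! h
    exact h1 (hc M h)
  have e1 : t (s + r - 1) = t s := by
    rw [← h2 (r - 1) (by omega)]
    congr 1; omega
  have e2 : ∀ m : ℕ, t (s + r + m) = t (s + (r + m : ℕ)) := fun m => by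
    congr 1; push_cast; ring
  have e3 : r + (M - r) = M := by omega
  refine ⟨⟨M - r, by omega, by rwa [e1], fun m hm => ?_, ?_, ?_⟩,
    ⟨M - r, by omega, by rw [e1]; exact hs.symm, fun m hm => ?_, ?_, ?_⟩⟩
  · rw [e2, h2 _ (by omega), h2 _ (by omega)]
  · rw [e2, e3, h2 (M - r) (by omega)]; exact h1.symm
  · rw [h2 _ (by omega)]; exact hs.symm
  · rw [e2, h2 _ (by omega), h2 _ (by omega)]
  · rw [e2, e3, h2 (M - r) (by omega)]; exact h1
  · rw [e2, e3, e1]; exact h1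

/-- A bi-infinite word of even period `n` in which neighbours differ and all letters occur. -/
structure IsPeriodicWord (n : ℕ) (W : ℤ → Letter) : Prop where
  pos : 2 ≤ n
  even : 2 ∣ n
  period : ∀ i, W (i + n) = W i
  ne : ∀ i, W i ≠ W (i + 1)
  surj : ∀ a, ∃ i, W i = a

namespace IsPeriodicWord

variable {n : ℕ} {W : ℤ → Letter}

lemma turn_period (h : IsPeriodicWord n W) (i : ℤ) : turnSeq W (i + n) = turnSeq W i := by
  have := h.even
  rw [turnSeq, turnSeq, h.period, par_add_even (by omega), add_right_comm, h.period]

lemma isStart_add_period (h : IsPeriodicWord n W) (i : ℤ) :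
    IsStart W (i + n) ↔ IsStart W i := by
  rw [IsStart, IsStart, show i + n - 1 = i - 1 + n by ring, h.turn_period, h.turn_period]

lemma isStart_succ_iff (h : IsPeriodicWord n W) (i : ℤ) :
    IsStart W (i + 1) ↔ W (i + 1 + 1) ≠ W i := by
  rw [IsStart, add_sub_cancel_right, turnSeq, turnSeq, par_add_one, Ne,
    turnOf_eq_turnOf_not (h.ne i) (h.ne (i + 1))]

lemma exists_isStart (h : IsPeriodicWord n W) : ∃ i, IsStart W i := by
  by_contra! hno
  have hstep : ∀ i, W (i + 1 + 1) = W i := fun i => by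
    have := hno (i + 1)
    rwa [h.isStart_succ_iff, not_not] at this
  have key : ∀ i, (W i = W 0 ∧ W (i + 1) = W 1) ∨ (W i = W 1 ∧ W (i + 1) = W 0) := by
    intro i
    induction i with
    | zero => exact Or.inl ⟨rfl, rfl⟩
    | succ i ih =>
      rw [hstep]
      tauto
    | pred i ih =>
      have := hstep (-(i : ℤ) - 1)
      rw [sub_add_cancel] at this ⊢
      rw [this] at ih
      tauto
  obtain ⟨i, hi⟩ := h.surj .x
  obtain ⟨j, hj⟩ := h.surj .y
  obtain ⟨k, hk⟩ := h.surj .z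
  have := key i
  have := key j
  have := key k
  cases h0 : W 0 <;> cases h1 : W 1 <;> simp_all

lemma exists_isStart_sub (h : IsPeriodicWord n W) (i : ℤ) : ∃ k : ℕ, IsStart W (i - k) := by
  obtain ⟨s, hs⟩ := h.exists_isStart
  have hsub : ∀ m : ℕ, IsStart W (s - m * n) := fun m => by
    induction m with
    | zero => simpa using hs
    | succ m ih =>
      rw [← h.isStart_add_period]
      convert ih using 1
      push_cast; ring
  have hn : (2 : ℤ) ≤ n := by exact_mod_cast h.pos
  have hle : s - (s - i).toNat * n ≤ i := by
    have := Int.self_le_toNat (s - i)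
    nlinarith [Int.natCast_nonneg (s - i).toNat]
  refine ⟨(i - (s - (s - i).toNat * n)).toNat, ?_⟩
  rw [Int.toNat_of_nonneg (by omega), sub_sub_cancel]
  exact hsub _

lemma isStart_sub_lag (h : IsPeriodicWord n W) (i : ℤ) : IsStart W (i - lag W i) :=
  Nat.sInf_mem (h.exists_isStart_sub i)

lemma lag_eq_zero (h : IsPeriodicWord n W) {i : ℤ} : lag W i = 0 ↔ IsStart W i := by
  constructor
  · intro h0
    simpa [h0] using h.isStart_sub_lag i
  · intro hi
    exact Nat.le_zero.mp (Nat.sInf_le (by simpa using hi))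

lemma lag_succ (h : IsPeriodicWord n W) {i : ℤ} (hi : ¬ IsStart W (i + 1)) :
    lag W (i + 1) = lag W i + 1 := by
  apply le_antisymm
  · apply Nat.sInf_le
    have := h.isStart_sub_lag i
    rw [Set.mem_ofPred_eq]
    convert this using 1
    push_cast; ring
  · have h0 : lag W (i + 1) ≠ 0 := fun h0 => hi (h.lag_eq_zero.mp h0)
    suffices lag W i ≤ lag W (i + 1) - 1 by omega
    apply Nat.sInf_le
    have := h.isStart_sub_lag (i + 1)
    rw [Set.mem_ofPred_eq]
    convert this using 1
    omega

lemma lag_add_period (h : IsPeriodicWord n W) (i : ℤ) : lag W (i + n) = lag W i := by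
  have : ∀ k : ℕ, IsStart W (i + n - k) ↔ IsStart W (i - k) := fun k => by
    rw [add_sub_right_comm, h.isStart_add_period]
  simp only [lag, this]

lemma not_isStart_of_lt_lag {i : ℤ} {k : ℕ} (hk : k < lag W i) : ¬ IsStart W (i - k) :=
  Nat.notMem_of_lt_sInf hk

lemma turn_run (i : ℤ) (m : ℕ) (hm : m ≤ lag W i) :
    turnSeq W (i - lag W i + m) = turnSeq W (i - lag W i) := by
  induction m with
  | zero => simp
  | succ m ih =>
    rw [← ih (by omega)]
    have := not_isStart_of_lt_lag (W := W) (i := i) (k := lag W i - (m + 1)) (by omega)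
    rw [IsStart, not_not] at this
    convert this.symm using 2 <;> omega

lemma letter_run (h : IsPeriodicWord n W) (i : ℤ) (m : ℕ) (hm : 2 * m ≤ lag W i) :
    W (i - lag W i + (2 * m : ℕ)) = W (i - lag W i) := by
  induction m with
  | zero => simp
  | succ m ih =>
    rw [← ih (by omega)]
    have hs := not_isStart_of_lt_lag (W := W) (i := i) (k := lag W i - (2 * m + 1)) (by omega)
    rw [show i - ((lag W i - (2 * m + 1) : ℕ) : ℤ) = i - lag W i + (2 * m : ℕ) + 1 by omega,
      h.isStart_succ_iff, not_not] at hs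
    rw [← hs]
    congr 1; push_cast; ring

/-- A position at positive even distance from the start of its run crosses that start. -/
lemma crossPair_lag (h : IsPeriodicWord n W) {i : ℤ} (hi : Even (lag W i)) (h0 : ¬ IsStart W i) :
    CrossPair n W (i - lag W i, i) ∧ CrossPair n W (i, i - lag W i) := by
  have h1 : lag W i ≠ 0 := fun e => h0 (h.lag_eq_zero.mp e)
  obtain ⟨m, hm⟩ := hi
  have hW := h.letter_run i m (by omega)
  have hpar := par_add_even (n := lag W i) (by omega) (i - lag W i)
  rw [show i - lag W i + (2 * m : ℕ) = i by omega] at hW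
  have hS := SamePair.of_run h.turn_period (by exact_mod_cast h.pos) (r := lag W i)
    (by omega) (h.isStart_sub_lag i) (fun m hm => turn_run i m hm)
  rw [sub_add_cancel] at hS hpar
  exact ⟨⟨hW.symm, Or.inl ⟨hpar.symm, hS.1⟩⟩, ⟨hW, Or.inl ⟨hpar, hS.2⟩⟩⟩

/-- Two starts with the same letter and different turns cross. -/
lemma crossPair_starts (h : IsPeriodicWord n W) {i j : ℤ} (hi : IsStart W i) (hj : IsStart W j)
    (hW : W i = W j) (ht : turnSeq W i ≠ turnSeq W j) : CrossPair n W (i, j) := by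
  refine ⟨hW, ?_⟩
  by_cases hp : par i = par j
  · refine Or.inl ⟨hp, 0, by have := h.pos; push_cast; omega, ?_, by simp, by simpa using ht,
      by simpa using hi.symm⟩
    rw [Bool.eq_not_of_ne hi, Bool.eq_not_of_ne hj]
    simpa using ht
  · exact Or.inr ⟨hp, hi, hj, ht⟩

end IsPeriodicWord

lemma Letter.eq_of_ne {p q c d : Letter} (hpq : p ≠ q) (h₁ : c ≠ p) (h₂ : c ≠ q) (h₃ : p ≠ d)
    (h₄ : q ≠ d) : c = d := by
  cases p <;> cases q <;> cases c <;> cases d <;> simp_all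

lemma exists_nat_lt_of_periodic {n : ℕ} (hn : 0 < n) {P : ℤ → Prop}
    (hP : ∀ i, P (i + n) ↔ P i) {i : ℤ} (hi : P i) (s : ℤ) : ∃ k : ℕ, k < n ∧ P (s + k) := by
  have hper : Function.Periodic P n := fun i => propext (hP i)
  have h0 := Int.emod_nonneg (i - s) (show (n : ℤ) ≠ 0 by omega)
  have h1 := Int.emod_lt_of_pos (i - s) (show (0 : ℤ) < n by omega)
  refine ⟨((i - s) % n).toNat, by omega, ?_⟩
  rw [Int.toNat_of_nonneg h0, ← hper.int_mul ((i - s) / n)]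
  convert hi using 1
  have := Int.emod_add_mul_ediv (i - s) n
  rw [Int.cast_id]
  linarith

namespace IsPeriodicWord

variable {n : ℕ} {W : ℤ → Letter}

lemma step_of_not_isStart (h : IsPeriodicWord n W) {i : ℤ} (hi : ¬ IsStart W (i + 1)) :
    W (i + 1 + 1) = W i ∧ turnSeq W (i + 1) = turnSeq W i ∧
      (Even (lag W (i + 1)) ↔ ¬ Even (lag W i)) := by
  refine ⟨?_, ?_, ?_⟩
  · rwa [h.isStart_succ_iff, not_not] at hi
  · rw [IsStart, not_not, add_sub_cancel_right] at hi
    exact hi.symm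
  · rw [h.lag_succ hi, Nat.even_add_one]

lemma step_of_isStart (h : IsPeriodicWord n W) {i : ℤ} (hi : IsStart W (i + 1)) :
    W (i + 1 + 1) ≠ W i ∧ turnSeq W (i + 1) = (!turnSeq W i) ∧ Even (lag W (i + 1)) := by
  refine ⟨(h.isStart_succ_iff i).mp hi, ?_, ?_⟩
  · rw [IsStart, add_sub_cancel_right] at hi
    exact Bool.eq_not_of_ne hi.symm
  · rw [h.lag_eq_zero.mpr hi]
    exact Even.zero

/-- Every letter starting a run starts runs of both kinds. -/
lemma exists_isStart_turn_ne (h : IsPeriodicWord n W) {i : ℤ} (hi : IsStart W i) :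
    ∃ j, IsStart W j ∧ W j = W i ∧ turnSeq W j ≠ turnSeq W i := by
  by_contra! hno
  set a := W i with ha
  set b := turnSeq W i with hb
  have key : ∀ m : ℕ,
      ((turnSeq W (i + m) ≠ b ∧ W (i + m) ≠ a ∧ W (i + m + 1) ≠ a) ∨
        (turnSeq W (i + m) = b ∧ (Even (lag W (i + m)) → W (i + m + 1) = a) ∧
          (¬ Even (lag W (i + m)) → W (i + m) = a))) ∨
      ((turnSeq W (i + m) = b ∧ (Even (lag W (i + m)) → W (i + m) = a) ∧
          (¬ Even (lag W (i + m)) → W (i + m + 1) = a)) ∧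
        ∀ m' : ℕ, 1 ≤ m' → m' ≤ m → ¬ IsStart W (i + m')) := by
    intro m
    induction m with
    | zero =>
      refine Or.inr ⟨⟨by simp [hb], by simp [ha], ?_⟩, fun m' h1 h2 => by omega⟩
      rw [Nat.cast_zero, add_zero, h.lag_eq_zero.mpr hi]
      simp
    | succ m ih =>
      rw [show i + ((m + 1 : ℕ) : ℤ) = i + m + 1 by push_cast; ring]
      have n1 := h.ne (i + m)
      have n2 := h.ne (i + m + 1)
      by_cases hs : IsStart W (i + m + 1)
      · left
        obtain ⟨s1, s2, s3⟩ := h.step_of_isStart hs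
        have s4 := hno _ hs
        rcases ih with (⟨c1, c2, c3⟩ | ⟨c1, c2, c3⟩) | ⟨⟨c1, c2, c3⟩, -⟩
        · have s5 : turnSeq W (i + m + 1) = b := by
            rw [s2, Bool.eq_not_of_ne c1, Bool.not_not]
          exact Or.inr ⟨s5, fun _ => Letter.eq_of_ne n1 s1 n2.symm c2 c3,
            fun h' => absurd s3 h'⟩
        all_goals
          have s5 : turnSeq W (i + m + 1) ≠ b := by rw [s2, c1]; simp
          have s6 : W (i + m + 1) ≠ a := fun e => s5 (s4 e)
          have s7 : W (i + m) = a := by tauto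
          exact Or.inl ⟨s5, s6, s7 ▸ s1⟩
      · obtain ⟨s1, s2, s3⟩ := h.step_of_not_isStart hs
        rw [s1, s2, s3, not_not]
        rcases ih with (⟨c1, c2, c3⟩ | ⟨c1, c2, c3⟩) | ⟨⟨c1, c2, c3⟩, c4⟩
        · exact Or.inl (Or.inl ⟨c1, c3, c2⟩)
        · exact Or.inl (Or.inr ⟨c1, c3, c2⟩)
        · refine Or.inr ⟨⟨c1, c3, c2⟩, fun m' h1 h2 => ?_⟩
          rcases h2.eq_or_lt with rfl | h2
          · push_cast
            rwa [← add_assoc]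
          · exact c4 m' h1 (by omega)
  have hlag : lag W (i + n) = 0 := by rw [h.lag_add_period, h.lag_eq_zero.mpr hi]
  have hpos := h.pos
  rcases key n with (⟨c1, -⟩ | ⟨-, c2, -⟩) | ⟨-, c4⟩
  · exact c1 (h.turn_period i)
  · have := c2 (by rw [hlag]; exact Even.zero)
    have hne := h.ne (i + n)
    rw [this, h.period] at hne
    exact hne rfl
  · exact c4 n (by omega) le_rfl ((h.isStart_add_period i).mpr hi)

/-- Either a given letter that starts a run starts a run of odd length, or it starts all runs. -/
lemma exists_odd_run (h : IsPeriodicWord n W) {i j : ℤ} (hi : IsStart W i) (hj : IsStart W j)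
    (hij : W i ≠ W j) : ∃ k, W k = W i ∧ IsStart W (k + 1) ∧ Even (lag W k) := by
  by_contra! hno
  set a := W i with ha
  have key : ∀ m : ℕ, (Even (lag W (i + m)) → W (i + m) = a) ∧
      (¬ Even (lag W (i + m)) → W (i + m + 1) = a) := by
    intro m
    induction m with
    | zero =>
      rw [Nat.cast_zero, add_zero, h.lag_eq_zero.mpr hi]
      simp [ha]
    | succ m ih =>
      rw [show i + ((m + 1 : ℕ) : ℤ) = i + m + 1 by push_cast; ring]
      by_cases hs : IsStart W (i + m + 1)
      · obtain ⟨s1, s2, s3⟩ := h.step_of_isStart hs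
        have s4 := hno (i + m)
        tauto
      · obtain ⟨s1, s2, s3⟩ := h.step_of_not_isStart hs
        rw [s1, s3, not_not]
        exact ⟨ih.2, ih.1⟩
  have hpos := h.pos
  obtain ⟨m, -, hs, hm⟩ := exists_nat_lt_of_periodic (by omega : 0 < n)
    (P := fun s => IsStart W s ∧ a ≠ W s)
    (fun s => by rw [h.isStart_add_period, h.period]) ⟨hj, hij⟩ i
  have := (key m).1
  rw [h.lag_eq_zero.mpr hs] at this
  exact hm (this Even.zero).symm

end IsPeriodicWord

/-! ### Counting crossing pairs -/

instance : Fintype Letter := ⟨{.x, .y, .z}, by rintro (_ | _ | _) <;> simp⟩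

/-- The starts in one period with letter `a` and turn `b`. -/
noncomputable def startsAt (n : ℕ) (W : ℤ → Letter) (a : Letter) (b : Bool) : Finset ℕ :=
  (Finset.range n).filter fun i => IsStart W i ∧ W i = a ∧ turnSeq W i = b

/-- The positions in one period at positive even distance from the start of their run. -/
noncomputable def evenInner (n : ℕ) (W : ℤ → Letter) : Finset ℕ :=
  (Finset.range n).filter fun i => Even (lag W i) ∧ ¬ IsStart W i

/-- The last positions of the runs of odd length in one period. -/
noncomputable def oddEnds (n : ℕ) (W : ℤ → Letter) : Finset ℕ :=
  (Finset.range n).filter fun i => IsStart W ((i : ℤ) + 1) ∧ Even (lag W i)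

lemma sum_ite_letter (c : Letter) (p q : Prop) [∀ a, Decidable (p ∧ c = a ∧ q)]
    [Decidable (p ∧ q)] :
    ∑ a, (if p ∧ c = a ∧ q then (1 : ℤ) else 0) = if p ∧ q then 1 else 0 := by
  have : ∀ a, (p ∧ c = a ∧ q) ↔ c = a ∧ p ∧ q := fun a => and_left_comm
  simp only [this]
  by_cases h : p ∧ q <;> simp [h]

namespace IsPeriodicWord

variable {n : ℕ} {W : ℤ → Letter}

lemma sum_sub_eq_zero {f : ℤ → ℤ} (hf : ∀ i, f (i + n) = f i) :
    ∑ i ∈ Finset.range n, (f ((i : ℤ) + 1) - f i) = 0 := by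
  have := Finset.sum_range_sub (fun i : ℕ => f i) n
  push_cast at this
  rw [this, ← zero_add (n : ℤ), hf, sub_self]

lemma two_mul_card_evenInner (h : IsPeriodicWord n W) :
    2 * ((evenInner n W).card : ℤ) + 2 * ∑ a, (((startsAt n W a true).card : ℤ) +
      (startsAt n W a false).card) = n + (oddEnds n W).card := by
  have h0 := sum_sub_eq_zero (n := n) (f := fun i => if Even (lag W i) then (1 : ℤ) else 0)
    (fun i => by rw [h.lag_add_period])
  simp only [startsAt, evenInner, oddEnds, Finset.natCast_card_filter]
  rw [Finset.sum_add_distrib, Finset.sum_comm, Finset.sum_comm (s := Finset.univ),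
    ← Finset.sum_add_distrib, Finset.mul_sum, Finset.mul_sum, ← Finset.sum_add_distrib]
  have hn : (n : ℤ) = ∑ i ∈ Finset.range n, 1 := by simp
  rw [hn, ← Finset.sum_add_distrib, ← sub_eq_zero, ← Finset.sum_sub_distrib, ← neg_eq_zero,
    ← Finset.sum_neg_distrib]
  refine (Finset.sum_congr rfl fun i _ => ?_).trans h0
  have he : IsStart W i → Even (lag W i) := fun hs => by
    rw [h.lag_eq_zero.mpr hs]; exact Even.zero
  have hs : ((if IsStart W i ∧ turnSeq W i = true then (1 : ℤ) else 0) +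
      if IsStart W i ∧ turnSeq W i = false then (1 : ℤ) else 0) = if IsStart W i then 1 else 0 := by
    by_cases h1 : IsStart W i <;> simp only [h1] <;> cases turnSeq W i <;> simp
  rw [sum_ite_letter, sum_ite_letter, hs]
  by_cases h1 : IsStart W (i + 1)
  · have h2 := (h.step_of_isStart h1).2.2
    by_cases h3 : Even (lag W i) <;> by_cases h4 : IsStart W i <;>
      first | exact absurd (he h4) h3 | (simp only [h1, h2, h3, h4]; norm_num)
  · have h2 := (h.step_of_not_isStart h1).2.2
    by_cases h3 : Even (lag W i) <;> by_cases h4 : IsStart W i <;>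
      first | exact absurd (he h4) h3 | (simp only [h1, h2, h3, h4]; norm_num)

lemma startsAt_nonempty (h : IsPeriodicWord n W) {i : ℤ} (hi : IsStart W i) (b : Bool) :
    0 < (startsAt n W (W i) b).card := by
  have hpos := h.pos
  obtain ⟨j, hj⟩ : ∃ j, IsStart W j ∧ W j = W i ∧ turnSeq W j = b := by
    by_cases hb : turnSeq W i = b
    · exact ⟨i, hi, rfl, hb⟩
    · obtain ⟨j, h1, h2, h3⟩ := h.exists_isStart_turn_ne hi
      exact ⟨j, h1, h2, (Bool.eq_not_of_ne h3).trans (Bool.eq_not_of_ne (Ne.symm hb)).symm⟩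
  obtain ⟨k, hk, hk'⟩ := exists_nat_lt_of_periodic (by omega : 0 < n)
    (P := fun j => IsStart W j ∧ W j = W i ∧ turnSeq W j = b)
    (fun j => by rw [h.isStart_add_period, h.period, h.turn_period]) hj 0
  rw [zero_add] at hk'
  exact Finset.card_pos.mpr ⟨k, Finset.mem_filter.mpr ⟨Finset.mem_range.mpr hk, hk'⟩⟩

/-- The number of letters at which the turn changes is bounded by the number of odd runs. -/
lemma card_start_letters_le (h : IsPeriodicWord n W) :
    (Finset.univ.filter fun a => ∃ i, IsStart W i ∧ W i = a).card ≤ max 1 (oddEnds n W).card := by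
  have hpos := h.pos
  set V := Finset.univ.filter fun a => ∃ i, IsStart W i ∧ W i = a with hV
  rcases le_or_gt V.card 1 with h1 | h1
  · exact h1.trans (le_max_left _ _)
  refine le_trans ?_ (le_max_right _ _)
  refine (Finset.card_le_card (t := (oddEnds n W).image fun i : ℕ => W i) ?_).trans
    Finset.card_image_le
  intro a ha
  obtain ⟨b, hb, hab⟩ := Finset.exists_mem_ne h1 a
  obtain ⟨i, hi, rfl⟩ := (Finset.mem_filter.mp ha).2
  obtain ⟨j, hj, rfl⟩ := (Finset.mem_filter.mp hb).2
  obtain ⟨k, hk⟩ := h.exists_odd_run hi hj hab.symm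
  obtain ⟨m, hm, hm'⟩ := exists_nat_lt_of_periodic (by omega : 0 < n)
    (P := fun k => W k = W i ∧ IsStart W (k + 1) ∧ Even (lag W k))
    (fun k => by rw [h.period, add_right_comm, h.isStart_add_period, h.lag_add_period]) hk 0
  rw [zero_add] at hm'
  exact Finset.mem_image.mpr
    ⟨m, Finset.mem_filter.mpr ⟨Finset.mem_range.mpr hm, hm'.2⟩, hm'.1⟩

lemma sub_two_le (h : IsPeriodicWord n W) :
    (n : ℤ) - 2 ≤ 2 * (evenInner n W).card +
      2 * ∑ a, ((startsAt n W a true).card : ℤ) * (startsAt n W a false).card := by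
  have hV := h.card_start_letters_le
  have hV3 : (Finset.univ.filter fun a => ∃ i, IsStart W i ∧ W i = a).card ≤ 3 :=
    Finset.card_le_univ _
  have hD := h.two_mul_card_evenInner
  have hF : ∑ a, (((startsAt n W a true).card : ℤ) + (startsAt n W a false).card) -
      (Finset.univ.filter fun a => ∃ i, IsStart W i ∧ W i = a).card ≤
      ∑ a, ((startsAt n W a true).card : ℤ) * (startsAt n W a false).card := by
    rw [Finset.natCast_card_filter, ← Finset.sum_sub_distrib]
    refine Finset.sum_le_sum fun a _ => ?_
    split_ifs with ha
    · obtain ⟨i, hi, rfl⟩ := ha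
      have h1 := h.startsAt_nonempty hi true
      have h2 := h.startsAt_nonempty hi false
      zify at h1 h2
      nlinarith
    · have h0 : ∀ b, startsAt n W a b = ∅ := fun b =>
        Finset.filter_eq_empty_iff.mpr fun i _ hi => ha ⟨i, hi.1, hi.2.1⟩
      simp [h0]
  have heven := h.even
  omega

end IsPeriodicWord

lemma eq_of_dvd_sub {n i j : ℕ} (hi : i < n) (hj : j < n) (h : (n : ℤ) ∣ (j : ℤ) - i) : i = j := by
  have := Int.eq_zero_of_abs_lt_dvd h (by rw [abs_lt]; omega)
  omega

/-- Indices of the crossing pairs of a periodic word. -/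
abbrev CrossIndex (n : ℕ) (W : ℤ → Letter) : Type :=
  (Σ c : Letter × Bool, startsAt n W c.1 c.2 × startsAt n W c.1 (!c.2)) ⊕
    (evenInner n W ⊕ evenInner n W)

/-- The crossing pair attached to an index. -/
noncomputable def crossIndexPair (n : ℕ) (W : ℤ → Letter) : CrossIndex n W → ℤ × ℤ
  | .inl ⟨_, i, j⟩ => ((i : ℕ), (j : ℕ))
  | .inr (.inl i) => ((i : ℕ) - lag W (i : ℕ), (i : ℕ))
  | .inr (.inr i) => ((i : ℕ), (i : ℕ) - lag W (i : ℕ))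

namespace IsPeriodicWord

variable {n : ℕ} {W : ℤ → Letter}

lemma sub_two_le_card (h : IsPeriodicWord n W) : (n : ℤ) - 2 ≤ Nat.card (CrossIndex n W) := by
  have h0 := h.sub_two_le
  rw [Nat.card_eq_fintype_card]
  simp only [CrossIndex, Fintype.card_sum, Fintype.card_sigma, Fintype.card_prod,
    Fintype.card_coe, Fintype.sum_prod_type, Fintype.sum_bool, Bool.not_true, Bool.not_false]
  push_cast
  rw [Finset.mul_sum] at h0
  have : ∀ a, ((startsAt n W a true).card : ℤ) * (startsAt n W a false).card +
      (startsAt n W a false).card * (startsAt n W a true).card =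
      2 * (((startsAt n W a true).card : ℤ) * (startsAt n W a false).card) := fun a => by ring
  simp only [this]
  linarith

lemma crossPair_crossIndexPair (h : IsPeriodicWord n W) (x : CrossIndex n W) :
    CrossPair n W (crossIndexPair n W x) := by
  rcases x with ⟨⟨a, b⟩, ⟨i, hi⟩, ⟨j, hj⟩⟩ | ⟨i, hi⟩ | ⟨i, hi⟩
  · obtain ⟨-, h1, h2, h3⟩ := Finset.mem_filter.mp hi
    obtain ⟨-, h1', h2', h3'⟩ := Finset.mem_filter.mp hj
    exact h.crossPair_starts h1 h1' (h2.trans h2'.symm) (by rw [h3, h3']; simp)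
  · obtain ⟨-, h1, h2⟩ := Finset.mem_filter.mp hi
    exact (h.crossPair_lag h1 h2).1
  · obtain ⟨-, h1, h2⟩ := Finset.mem_filter.mp hi
    exact (h.crossPair_lag h1 h2).2

lemma isStart_iff_of_dvd (h : IsPeriodicWord n W) {i j : ℤ} (hij : (n : ℤ) ∣ j - i) :
    IsStart W j ↔ IsStart W i := by
  have hper : Function.Periodic (IsStart W) n := fun i => propext (h.isStart_add_period i)
  obtain ⟨m, hm⟩ := hij
  have := hper.int_mul m i
  rw [Int.cast_id, show i + m * n = j by linarith] at this
  rw [this]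

lemma crossIndexPair_injective (h : IsPeriodicWord n W) {x y : CrossIndex n W}
    (h₁ : (n : ℤ) ∣ (crossIndexPair n W y).1 - (crossIndexPair n W x).1)
    (h₂ : (n : ℤ) ∣ (crossIndexPair n W y).2 - (crossIndexPair n W x).2) : x = y := by
  have s1 := h.isStart_iff_of_dvd h₁
  have s2 := h.isStart_iff_of_dvd h₂
  rcases x with ⟨⟨a, b⟩, ⟨i, hi⟩, ⟨j, hj⟩⟩ | ⟨i, hi⟩ | ⟨i, hi⟩ <;>
    rcases y with ⟨⟨a', b'⟩, ⟨i', hi'⟩, ⟨j', hj'⟩⟩ | ⟨i', hi'⟩ | ⟨i', hi'⟩ <;>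
    have ki := Finset.mem_filter.mp hi <;>
    have ki' := Finset.mem_filter.mp hi' <;>
    have li := h.isStart_sub_lag i <;>
    have li' := h.isStart_sub_lag i' <;>
    rw [Finset.mem_range] at ki ki' <;>
    simp only [crossIndexPair] at h₁ h₂ s1 s2
  · have kj := Finset.mem_filter.mp hj
    have kj' := Finset.mem_filter.mp hj'
    rw [Finset.mem_range] at kj kj'
    obtain rfl := eq_of_dvd_sub ki.1 ki'.1 h₁
    obtain rfl := eq_of_dvd_sub kj.1 kj'.1 h₂
    obtain ⟨-, -, h1, h2⟩ := ki
    obtain ⟨-, -, h1', h2'⟩ := ki'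
    simp only at h1 h2 h1' h2'
    obtain rfl := h1.symm.trans h1'
    obtain rfl := h2.symm.trans h2'
    rfl
  · have kj := Finset.mem_filter.mp hj
    tauto
  · tauto
  · have kj := Finset.mem_filter.mp hj'
    tauto
  · obtain rfl := eq_of_dvd_sub ki.1 ki'.1 h₂
    rfl
  · tauto
  · tauto
  · tauto
  · obtain rfl := eq_of_dvd_sub ki.1 ki'.1 h₁
    rfl

end IsPeriodicWord

lemma isPeriodicWord_unroll {w : List Letter} (hw : CyclRed w) (heven : 2 ∣ w.length)
    (hlen : 4 ≤ w.length) (hall : ∀ l : Letter, l ∈ w) :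
    IsPeriodicWord w.length (unroll w) where
  pos := by omega
  even := heven
  period := unroll_period w
  ne := unroll_ne hw
  surj a := exists_unroll_eq (hall a)

theorem almost_simple_geodesics_stmt0 (w : List Letter) (hcr : CyclRed w)
    (heven : 2 ∣ w.length) (hlen : 4 ≤ w.length) (hall : ∀ l : Letter, l ∈ w) :
    Hyperbolic (phiM w) ∧ Lw w - 1 ≤ Iw w := by
  have h := isPeriodicWord_unroll hcr heven hlen hall
  obtain ⟨i, hi⟩ := h.exists_isStart
  have hyp := hyperbolic_phiM hcr heven h.pos hi
  refine ⟨hyp, le_Iw hcr heven h.pos hyp (crossIndexPair w.length (unroll w))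
    h.crossPair_crossIndexPair (fun _ _ => h.crossIndexPair_injective) ?_⟩
  have := h.sub_two_le_card
  rw [Lw]
  omega
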